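/- arXiv:0903.2867 — 3 statements merged into one kernel-verified Lean document; each statement's English description precedes it below -/
import Mathlib

section
/- Suppose k ≥ 3 and 1 ≤ ℓ ≤ k−1. For all μ > 0 and ε > 0 with ε < μ there exist an integer D and an integer n₀ such that the following holds for all n ≥ n₀. Let H be a k-graph of order n with minimum degree δ(H) ≥ (1/(⌈k/(k−ℓ)⌉(k−ℓ)) + μ)·n. Then H contains a set of at most D pairwise vertex-disjoint ℓ-paths covering all but at most εn vertices of H. -/
open Finset

/-- `H` is (the edge set of) a `k`-uniform hypergraph on vertex set `Fin n`. -/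
def IsKGraph (n k : ℕ) (H : Finset (Finset (Fin n))) : Prop := ∀ e ∈ H, e.card = k

/-- The degree of a vertex set `A` in `H`: the number of edges containing `A`. -/
def degree (n : ℕ) (H : Finset (Finset (Fin n))) (A : Finset (Fin n)) : ℕ :=
  (H.filter (fun e => A ⊆ e)).card

/-- The minimum `(k-1)`-degree of `H` is at least `x`. -/
def MinDegreeGe (n k : ℕ) (H : Finset (Finset (Fin n))) (x : ℝ) : Prop :=
  ∀ A : Finset (Fin n), A.card = k - 1 → x ≤ (degree n H A : ℝ)

/-- `⌈k / d⌉` for natural numbers. -/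
def ceilQuot (k d : ℕ) : ℕ := (k + d - 1) / d

/-- The edge of an `ℓ`-path starting at position `s * (k - ℓ)` of the vertex
sequence `v`: it consists of the `k` consecutive vertices from that position. -/
def pathEdge (k ℓ : ℕ) {α : Type*} [DecidableEq α] (v : ℕ → α) (s : ℕ) : Finset α :=
  (Finset.range k).image (fun t => v (s * (k - ℓ) + t))

/-- `v` (restricted to its first `r` values) is a vertex sequence of an `ℓ`-path
all of whose edges satisfy the edge predicate `E`. -/
def IsPathSeq (k ℓ r : ℕ) {α : Type*} [DecidableEq α] (E : Finset α → Prop) (v : ℕ → α) : Prop :=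
  k ≤ r ∧ (k - ℓ) ∣ (r - k) ∧ Set.InjOn v (Set.Iio r) ∧
    ∀ s : ℕ, s * (k - ℓ) + k ≤ r → E (pathEdge k ℓ v s)

lemma exists_core {α : Type*} [DecidableEq α] (t : ℕ) :
    ∀ (N : ℕ) (E : Finset (Finset α)), E.card = N → t * (E.shadow).card < E.card →
    ∃ F ⊆ E, F.Nonempty ∧ ∀ e ∈ F, ∀ x ∈ e, t ≤ (F.filter (fun f => e.erase x ⊆ f)).card := by
  intro N
  induction N using Nat.strong_induction_on with
  | _ N ih =>
    intro E hN hE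
    by_cases hgood : ∀ e ∈ E, ∀ x ∈ e, t ≤ (E.filter (fun f => e.erase x ⊆ f)).card
    · exact ⟨E, Finset.Subset.refl _, Finset.card_pos.mp (by omega), hgood⟩
    · push Not at hgood
      obtain ⟨e, he, x, hx, hlt⟩ := hgood
      set B := e.erase x with hB
      set E' := E.filter (fun f => ¬ B ⊆ f) with hE'
      have hBs : B ∈ E.shadow := Finset.mem_shadow_iff.mpr ⟨e, he, x, hx, rfl⟩
      have hsum : (E.filter (fun f => B ⊆ f)).card + E'.card = E.card :=
        Finset.card_filter_add_card_filter_not _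
      have hpos : 0 < (E.filter (fun f => B ⊆ f)).card :=
        Finset.card_pos.mpr ⟨e, by simp [he, hB, Finset.erase_subset]⟩
      have hsub : E'.shadow ⊆ E.shadow.erase B := by
        intro C hC
        rw [Finset.mem_shadow_iff] at hC
        obtain ⟨f, hf, y, hy, rfl⟩ := hC
        rw [hE', Finset.mem_filter] at hf
        rw [Finset.mem_erase]
        refine ⟨?_, Finset.mem_shadow_iff.mpr ⟨f, hf.1, y, hy, rfl⟩⟩
        intro h
        exact hf.2 (h ▸ Finset.erase_subset _ _)
      have hc := Finset.card_le_card hsub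
      rw [Finset.card_erase_of_mem hBs] at hc
      have hsp : 0 < E.shadow.card := Finset.card_pos.mpr ⟨B, hBs⟩
      have h1 : t * E'.shadow.card + t ≤ t * E.shadow.card := by
        have : E'.shadow.card + 1 ≤ E.shadow.card := by omega
        calc t * E'.shadow.card + t = t * (E'.shadow.card + 1) := by ring
          _ ≤ _ := Nat.mul_le_mul_left _ this
      obtain ⟨F, hF, h2⟩ := ih E'.card (by omega) E' rfl (by omega)
      exact ⟨F, hF.trans (Finset.filter_subset _ _), h2⟩

lemma exchange_one {α : Type*} [DecidableEq α] {t k : ℕ} {F : Finset (Finset α)}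
    (hF : ∀ e ∈ F, e.card = k)
    (hdeg : ∀ e ∈ F, ∀ x ∈ e, t ≤ (F.filter (fun f => e.erase x ⊆ f)).card)
    {e : Finset α} (he : e ∈ F) {x : α} (hx : x ∈ e) (W : Finset α) (hW : W.card < t) :
    ∃ y, y ∉ W ∧ y ∉ e.erase x ∧ insert y (e.erase x) ∈ F := by
  have h1 := hdeg e he x hx
  have h2 : (W.image (fun y => insert y (e.erase x))).card <
      (F.filter (fun f => e.erase x ⊆ f)).card :=
    lt_of_le_of_lt Finset.card_image_le (by omega)
  obtain ⟨f, hf, hfn⟩ := Finset.exists_mem_notMem_of_card_lt_card h2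
  rw [Finset.mem_filter] at hf
  have hc : (f \ e.erase x).card = 1 := by
    have hc1 := Finset.card_sdiff_add_card_eq_card hf.2
    have hc2 := Finset.card_erase_of_mem hx
    have hc3 : 0 < e.card := Finset.card_pos.mpr ⟨x, hx⟩
    have := hF e he
    have := hF f hf.1
    omega
  obtain ⟨y, hy⟩ := Finset.card_eq_one.mp hc
  have hfe : insert y (e.erase x) = f := by
    rw [Finset.insert_eq, ← hy, Finset.sdiff_union_of_subset hf.2]
  have hyf : y ∈ f \ e.erase x := by rw [hy]; simp
  refine ⟨y, ?_, (Finset.mem_sdiff.mp hyf).2, hfe ▸ hf.1⟩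
  intro hyW
  exact hfn (Finset.mem_image.mpr ⟨y, hyW, hfe⟩)

lemma exchange_many {α : Type*} [DecidableEq α] {t k : ℕ} {F : Finset (Finset α)}
    (hF : ∀ e ∈ F, e.card = k)
    (hdeg : ∀ e ∈ F, ∀ x ∈ e, t ≤ (F.filter (fun f => e.erase x ⊆ f)).card)
    {e : Finset α} (he : e ∈ F) (W : Finset α) (heW : e ⊆ W) (R : Finset α) :
    R ⊆ e → W.card + R.card ≤ t →
    ∃ Y : Finset α, Y.card = R.card ∧ Disjoint Y W ∧ (e \ R) ∪ Y ∈ F := by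
  induction R using Finset.induction_on with
  | empty => intro _ _; exact ⟨∅, by simp [he]⟩
  | insert x R hxR ih =>
    intro hR ht
    rw [Finset.card_insert_of_notMem hxR] at ht
    obtain ⟨Y, hY1, hY2, hY3⟩ := ih (fun z hz => hR (Finset.mem_insert_of_mem hz)) (by omega)
    have hxe : x ∈ e := hR (Finset.mem_insert_self _ _)
    have hxY : x ∉ Y := fun h => (Finset.disjoint_left.mp hY2 h) (heW hxe)
    have hx' : x ∈ (e \ R) ∪ Y := by simp [hxe, hxR]
    have hWY : (W ∪ Y).card < t := by
      have := Finset.card_union_le W Y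
      omega
    obtain ⟨y, hy1, hy2, hy3⟩ := exchange_one hF hdeg hY3 hx' (W ∪ Y) hWY
    have hyW : y ∉ W := fun h => hy1 (Finset.mem_union_left _ h)
    have hyY : y ∉ Y := fun h => hy1 (Finset.mem_union_right _ h)
    refine ⟨insert y Y, ?_, ?_, ?_⟩
    · rw [Finset.card_insert_of_notMem hyY, Finset.card_insert_of_notMem hxR, hY1]
    · rw [Finset.disjoint_insert_left]; exact ⟨hyW, hY2⟩
    · convert hy3 using 1
      ext z
      simp only [Finset.mem_union, Finset.mem_sdiff, Finset.mem_insert, Finset.mem_erase]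
      by_cases hzx : z = x
      · subst hzx; simp [hxY]
      · simp [hzx]; tauto

lemma exists_enum {α : Type*} [DecidableEq α] {r : ℕ} {Y : Finset α} (hY : Y.card = r)
    {y : α} (hy : y ∈ Y) :
    ∃ g : ℕ → α, Set.InjOn g (Set.Iio r) ∧ (Finset.range r).image g = Y ∧ g (r - 1) = y := by
  have hr : 0 < r := hY ▸ Finset.card_pos.mpr ⟨y, hy⟩
  have hc : (Y.erase y).card = r - 1 := by rw [Finset.card_erase_of_mem hy, hY]
  let f := (Y.erase y).equivFinOfCardEq hc
  let g : ℕ → α := fun i => if h : i < r - 1 then (f.symm ⟨i, h⟩ : α) else y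
  have hg : ∀ i, i < r - 1 → g i ∈ Y.erase y := by
    intro i hi
    simp only [g, hi, dif_pos]
    exact (f.symm ⟨i, hi⟩).2
  have hgl : g (r - 1) = y := by simp [g]
  have hinj : Set.InjOn g (Set.Iio r) := by
    intro i hi j hj hij
    simp only [Set.mem_Iio] at hi hj
    by_cases h1 : i < r - 1 <;> by_cases h2 : j < r - 1
    · simp only [g, h1, h2, dif_pos] at hij
      have := f.symm.injective (Subtype.ext hij)
      simpa using this
    · have h3 : j = r - 1 := by omega
      have := hg i h1
      rw [hij, h3, hgl] at this
      simp at this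
    · have h3 : i = r - 1 := by omega
      have := hg j h2
      rw [← hij, h3, hgl] at this
      simp at this
    · omega
  refine ⟨g, hinj, ?_, hgl⟩
  apply Finset.eq_of_subset_of_card_le
  · intro z hz
    obtain ⟨i, hi, rfl⟩ := Finset.mem_image.mp hz
    rw [Finset.mem_range] at hi
    by_cases h1 : i < r - 1
    · exact Finset.mem_of_mem_erase (hg i h1)
    · have h3 : i = r - 1 := by omega
      rw [h3, hgl]; exact hy
  · rw [Finset.card_image_of_injOn, Finset.card_range, hY]
    intro i hi j hj
    exact hinj (by simpa using hi) (by simpa using hj)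

lemma exists_path {α : Type*} [DecidableEq α] {t k ℓ : ℕ} (hl : ℓ < k)
    {F : Finset (Finset α)}
    (hF : ∀ e ∈ F, e.card = k) (hne : F.Nonempty)
    (hdeg : ∀ e ∈ F, ∀ x ∈ e, t ≤ (F.filter (fun f => e.erase x ⊆ f)).card)
    (S T : Finset α) (hS : ∀ e ∈ F, (e ∩ S).card = 1) (hT : ∀ e ∈ F, e ⊆ T) (hl0 : 0 < ℓ)
    (J : ℕ) : J * (k - ℓ) + k ≤ t →
    ∃ v : ℕ → α, Set.InjOn v (Set.Iio (J * (k - ℓ) + k)) ∧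
      (∀ s ≤ J, pathEdge k ℓ v s ∈ F) ∧
      (∀ p < J * (k - ℓ) + k, v p ∈ T) ∧
      ∃ c : ℕ, J * (k - ℓ) ≤ k - 1 + c * (((k - 1) / (k - ℓ) + 1) * (k - ℓ)) ∧
        k - 1 + c * (((k - 1) / (k - ℓ) + 1) * (k - ℓ)) < J * (k - ℓ) + k ∧
        v (k - 1 + c * (((k - 1) / (k - ℓ) + 1) * (k - ℓ))) ∈ S ∧
        (((Finset.range (J * (k - ℓ) + k)).image v) ∩ S).card ≤ c + 1 := by
  induction J with
  | zero =>
    intro ht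
    obtain ⟨e, he⟩ := hne
    obtain ⟨y, hy⟩ := Finset.card_pos.mp (by rw [hS e he]; exact one_pos : 0 < (e ∩ S).card)
    rw [Finset.mem_inter] at hy
    obtain ⟨g, hg1, hg2, hg3⟩ := exists_enum (hF e he) hy.1
    refine ⟨g, by simpa using hg1, ?_, ?_, 0, by simp, by simp; omega, ?_, ?_⟩
    · intro s hs
      obtain rfl : s = 0 := by omega
      simpa [pathEdge, hg2] using he
    · intro p hp
      apply hT e he
      rw [← hg2]
      exact Finset.mem_image_of_mem _ (by simpa using hp)
    · simp [hg3, hy.2]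
    · simp [hg2, hS e he]
  | succ J ih =>
    intro ht
    set r := k - ℓ with hr
    have hr0 : 0 < r := by omega
    have hrk : r < k := by omega
    have hJ : (J + 1) * r = J * r + r := by ring
    rw [hJ] at ht ⊢
    obtain ⟨v, hv1, hv2, hvT, c, hc1, hc2, hc3, hc4⟩ := ih (by omega)
    clear ih
    set a := ((k - 1) / r + 1) * r with ha
    set P := k - 1 + c * a with hP
    set L := J * r + k with hL
    set e := pathEdge k ℓ v J with he
    have heF : e ∈ F := hv2 J le_rfl
    have hmem : ∀ z, z ∈ e ↔ ∃ p, J * r ≤ p ∧ p < L ∧ v p = z := by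
      intro z
      simp only [he, pathEdge, Finset.mem_image, Finset.mem_range, ← hr]
      constructor
      · rintro ⟨i, hi, rfl⟩; exact ⟨J * r + i, by omega, by omega, rfl⟩
      · rintro ⟨p, hp1, hp2, rfl⟩
        exact ⟨p - J * r, by omega, by congr 1; omega⟩
    set W := (Finset.range L).image v with hW
    have heW : e ⊆ W := by
      intro z hz
      obtain ⟨p, hp1, hp2, rfl⟩ := (hmem z).mp hz
      exact Finset.mem_image_of_mem _ (by simpa using hp2)
    set R := (Finset.range r).image (fun i => v (J * r + i)) with hR
    have hmemR : ∀ z, z ∈ R ↔ ∃ p, J * r ≤ p ∧ p < J * r + r ∧ v p = z := by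
      intro z
      simp only [hR, Finset.mem_image, Finset.mem_range]
      constructor
      · rintro ⟨i, hi, rfl⟩; exact ⟨J * r + i, by omega, by omega, rfl⟩
      · rintro ⟨p, hp1, hp2, rfl⟩
        exact ⟨p - J * r, by omega, by congr 1; omega⟩
    have hRe : R ⊆ e := by
      intro z hz
      obtain ⟨p, hp1, hp2, rfl⟩ := (hmemR z).mp hz
      exact (hmem _).mpr ⟨p, hp1, by omega, rfl⟩
    have hWc : W.card ≤ L := by
      have := Finset.card_image_le (s := Finset.range L) (f := v)
      simpa using this
    have hRc : R.card = r := by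
      rw [hR, Finset.card_image_of_injOn, Finset.card_range]
      intro i hi j hj hij
      simp only [Finset.coe_range, Set.mem_Iio] at hi hj
      have := hv1 (show J * r + i ∈ Set.Iio L by simp only [Set.mem_Iio]; omega)
        (show J * r + j ∈ Set.Iio L by simp only [Set.mem_Iio]; omega) hij
      omega
    obtain ⟨Y, hY1, hY2, hY3⟩ := exchange_many hF hdeg heF W heW R hRe (by omega)
    have hdiff : ∀ z, z ∈ e \ R ↔ ∃ p, J * r + r ≤ p ∧ p < L ∧ v p = z := by
      intro z
      rw [Finset.mem_sdiff, hmem, hmemR]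
      constructor
      · rintro ⟨⟨p, hp1, hp2, rfl⟩, h⟩
        refine ⟨p, ?_, hp2, rfl⟩
        by_contra hlt
        exact h ⟨p, hp1, by omega, rfl⟩
      · rintro ⟨p, hp1, hp2, rfl⟩
        refine ⟨⟨p, by omega, hp2, rfl⟩, ?_⟩
        rintro ⟨p', hp1', hp2', h⟩
        have := hv1 (show p' ∈ Set.Iio L by simp only [Set.mem_Iio]; omega)
          (show p ∈ Set.Iio L by simp only [Set.mem_Iio]; omega) h
        omega
    have hPe : v P ∈ e := (hmem _).mpr ⟨P, hc1, hc2, rfl⟩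
    obtain ⟨w, hw⟩ := Finset.card_eq_one.mp (hS _ hY3)
    obtain ⟨u, hu⟩ := Finset.card_eq_one.mp (hS _ heF)
    have hwS : w ∈ S ∧ (w ∈ e \ R ∨ w ∈ Y) := by
      have : w ∈ ((e \ R) ∪ Y) ∩ S := by rw [hw]; simp
      simp only [Finset.mem_inter, Finset.mem_union] at this
      exact ⟨this.2, this.1⟩
    have hwu : ∀ z ∈ S, (z ∈ e \ R ∨ z ∈ Y) → z = w := by
      intro z hz h
      have : z ∈ ((e \ R) ∪ Y) ∩ S := by
        simp only [Finset.mem_inter, Finset.mem_union]; exact ⟨h, hz⟩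
      rw [hw] at this; simpa using this
    have huu : ∀ z ∈ S, z ∈ e → z = v P := by
      intro z hz h
      have h1 : z ∈ e ∩ S := by simp [h, hz]
      have h2 : v P ∈ e ∩ S := by simp [hPe, hc3]
      rw [hu, Finset.mem_singleton] at h1 h2
      rw [h1, h2]
    have hYne : Y.Nonempty := Finset.card_pos.mp (by omega)
    -- last vertex of the new block
    obtain ⟨y, hyY, hylast⟩ : ∃ y ∈ Y, ∀ z ∈ Y, z ∈ S → z = y := by
      by_cases hwY : w ∈ Y
      · exact ⟨w, hwY, fun z hz hzS => hwu z hzS (Or.inr hz)⟩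
      · obtain ⟨y, hy⟩ := hYne
        exact ⟨y, hy, fun z hz hzS => absurd (hwu z hzS (Or.inr hz) ▸ hz) hwY⟩
    obtain ⟨g, hg1, hg2, hg3⟩ := exists_enum (hY1.trans hRc) hyY
    have hgY : ∀ i, i < r → g i ∈ Y := fun i hi => by
      rw [← hg2]; exact Finset.mem_image_of_mem _ (by simpa using hi)
    set v' : ℕ → α := fun p => if p < L then v p else g (p - L) with hv'
    have hv'1 : ∀ p, p < L → v' p = v p := fun p hp => by simp [hv', hp]
    have hv'2 : ∀ p, L ≤ p → v' p = g (p - L) := fun p hp => by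
      simp [hv', not_lt.mpr hp]
    have hvW : ∀ p, p < L → v p ∈ W := fun p hp =>
      Finset.mem_image_of_mem _ (by simpa using hp)
    have hsplit : (Finset.range (J * r + r + k)).image v' = W ∪ Y := by
      ext z
      simp only [Finset.mem_image, Finset.mem_range, Finset.mem_union, hW]
      constructor
      · rintro ⟨p, hp, rfl⟩
        by_cases h : p < L
        · left; exact ⟨p, h, (hv'1 p h).symm⟩
        · right; rw [hv'2 p (by omega)]; exact hgY _ (by omega)
      · rintro (⟨p, hp, rfl⟩ | hz)
        · exact ⟨p, by omega, hv'1 p hp⟩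
        · rw [← hg2] at hz
          obtain ⟨i, hi, rfl⟩ := Finset.mem_image.mp hz
          rw [Finset.mem_range] at hi
          exact ⟨L + i, by omega, by rw [hv'2 _ (by omega)]; congr 1; omega⟩
    refine ⟨v', ?_, ?_, ?_, ?_⟩
    · intro i hi j hj hij
      simp only [Set.mem_Iio] at hi hj
      by_cases h1 : i < L <;> by_cases h2 : j < L
      · rw [hv'1 i h1, hv'1 j h2] at hij
        exact hv1 h1 h2 hij
      · rw [hv'1 i h1, hv'2 j (by omega)] at hij
        exact absurd (hij ▸ hvW i h1) (Finset.disjoint_left.mp hY2 (hgY _ (by omega)))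
      · rw [hv'2 i (by omega), hv'1 j h2] at hij
        exact absurd (hij ▸ hvW j h2) (Finset.disjoint_left.mp hY2 (hgY _ (by omega)))
      · rw [hv'2 i (by omega), hv'2 j (by omega)] at hij
        have := hg1 (show i - L ∈ Set.Iio r by simp only [Set.mem_Iio]; omega)
          (show j - L ∈ Set.Iio r by simp only [Set.mem_Iio]; omega) hij
        omega
    · intro s hs
      rcases Nat.lt_or_ge J s with h | h
      · obtain rfl : s = J + 1 := by omega
        convert hY3 using 1
        ext z
        rw [Finset.mem_union, hdiff]
        simp only [pathEdge, Finset.mem_image, Finset.mem_range, ← hr, hJ]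
        constructor
        · rintro ⟨i, hi, rfl⟩
          by_cases h1 : J * r + r + i < L
          · left; exact ⟨_, by omega, h1, (hv'1 _ h1).symm⟩
          · right; rw [hv'2 _ (by omega)]; exact hgY _ (by omega)
        · rintro (⟨p, hp1, hp2, rfl⟩ | hz)
          · exact ⟨p - (J * r + r), by omega, by
              rw [← hv'1 p hp2]; congr 1; omega⟩
          · rw [← hg2] at hz
            obtain ⟨i, hi, rfl⟩ := Finset.mem_image.mp hz
            rw [Finset.mem_range] at hi
            exact ⟨L + i - (J * r + r), by omega, by
              rw [hv'2 _ (by omega)]; congr 1; omega⟩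
      · have : pathEdge k ℓ v' s = pathEdge k ℓ v s := by
          unfold pathEdge
          apply Finset.image_congr
          intro i hi
          simp only [Finset.coe_range, Set.mem_Iio] at hi
          apply hv'1
          have : s * r ≤ J * r := Nat.mul_le_mul_right _ h
          rw [← hr]
          omega
        rw [this]; exact hv2 s h
    · intro p hp
      by_cases h : p < L
      · rw [hv'1 p h]; exact hvT p h
      · rw [hv'2 p (by omega)]
        exact hT _ hY3 (Finset.mem_union_right _ (hgY _ (by omega)))
    · rw [hsplit]
      by_cases hcase : J * r + r ≤ P
      · refine ⟨c, hcase, by omega, ?_, ?_⟩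
        · rw [hv'1 P (by omega)]; exact hc3
        · have hYS : Y ∩ S = ∅ := by
            rw [Finset.eq_empty_iff_forall_notMem]
            intro z hz
            rw [Finset.mem_inter] at hz
            have h1 := hwu z hz.2 (Or.inr hz.1)
            have h2 := hwu (v P) hc3 (Or.inl ((hdiff _).mpr ⟨P, hcase, hc2, rfl⟩))
            have h3 : v P ∈ Y := by rw [h2, ← h1]; exact hz.1
            exact Finset.disjoint_left.mp hY2 h3 (heW hPe)
          rw [Finset.union_inter_distrib_right, hYS, Finset.union_empty]
          exact hc4
      · have hPR : v P ∈ R := (hmemR _).mpr ⟨P, hc1, by omega, rfl⟩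
        have hwY : w ∈ Y := by
          rcases hwS.2 with h | h
          · rw [Finset.mem_sdiff] at h
            exact absurd (huu w hwS.1 h.1 ▸ hPR) h.2
          · exact h
        have hyw : w = y := hylast w hwY hwS.1
        have hkey : k - 1 + (c + 1) * a = J * r + r + (k - 1) := by
          have h1 : c * ((k - 1) / r + 1) ≤ J := by
            by_contra hcon
            have h2 : (J + 1) * r ≤ c * ((k - 1) / r + 1) * r :=
              Nat.mul_le_mul_right _ (by omega)
            have h3 : c * ((k - 1) / r + 1) * r = c * a := by rw [ha]; ring
            omega
          obtain ⟨j, hj⟩ := Nat.exists_eq_add_of_le h1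
          have h3 : J * r = c * a + j * r := by rw [hj, ha]; ring
          have h4 : (k - 1) / r = j := by
            apply Nat.div_eq_of_lt_le
            · omega
            · rw [add_mul, one_mul]; omega
          rw [h3]
          have : a = j * r + r := by rw [ha, h4]; ring
          rw [add_mul, one_mul]; omega
        have hge : L ≤ J * r + r + (k - 1) := by omega
        refine ⟨c + 1, ?_, ?_, ?_, ?_⟩
        · rw [hkey]; omega
        · rw [hkey]; omega
        · rw [hkey, hv'2 (J * r + r + (k - 1)) hge]
          have : J * r + r + (k - 1) - L = r - 1 := by omega
          rw [this, hg3, ← hyw]; exact hwS.1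
        · have hYS : Y ∩ S ⊆ {y} := by
            intro z hz
            rw [Finset.mem_inter] at hz
            rw [Finset.mem_singleton]; exact hylast z hz.1 hz.2
          have h1 := Finset.card_le_card hYS
          rw [Finset.union_inter_distrib_right]
          have h2 := Finset.card_union_le (W ∩ S) (Y ∩ S)
          rw [Finset.card_singleton] at h1
          omega

/-- Number of `(k-1)`-subsets of `U` forming an edge together with `v`. -/
def linkDeg {n : ℕ} (H : Finset (Finset (Fin n))) (k : ℕ) (U : Finset (Fin n)) (v : Fin n) : ℕ :=
  ((U.powersetCard (k - 1)).filter (fun A => v ∉ A ∧ insert v A ∈ H)).card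

lemma linkDeg_le {n : ℕ} (H : Finset (Finset (Fin n))) (k : ℕ) (U : Finset (Fin n)) (v : Fin n) :
    linkDeg H k U v ≤ U.card.choose (k - 1) := by
  unfold linkDeg
  refine (Finset.card_filter_le _ _).trans ?_
  rw [Finset.card_powersetCard]

lemma linkDeg_sdiff {n : ℕ} (H : Finset (Finset (Fin n))) (k : ℕ) (hk : 2 ≤ k)
    (U W : Finset (Fin n)) (v : Fin n) :
    linkDeg H k U v ≤ linkDeg H k (U \ W) v + W.card * n ^ (k - 2) := by
  unfold linkDeg
  have hsub : (U.powersetCard (k - 1)).filter (fun A => v ∉ A ∧ insert v A ∈ H) ⊆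
      ((U \ W).powersetCard (k - 1)).filter (fun A => v ∉ A ∧ insert v A ∈ H) ∪
      W.biUnion (fun w => ((Finset.univ : Finset (Fin n)).powersetCard (k - 2)).image
        (fun B => insert w B)) := by
    intro A hA
    rw [Finset.mem_filter, Finset.mem_powersetCard] at hA
    rw [Finset.mem_union]
    by_cases h : ∃ w ∈ W, w ∈ A
    · right
      obtain ⟨w, hw, hwA⟩ := h
      rw [Finset.mem_biUnion]
      refine ⟨w, hw, Finset.mem_image.mpr ⟨A.erase w, ?_, Finset.insert_erase hwA⟩⟩
      rw [Finset.mem_powersetCard]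
      refine ⟨Finset.subset_univ _, ?_⟩
      rw [Finset.card_erase_of_mem hwA, hA.1.2]; omega
    · left
      push Not at h
      rw [Finset.mem_filter, Finset.mem_powersetCard]
      refine ⟨⟨fun z hz => ?_, hA.1.2⟩, hA.2⟩
      rw [Finset.mem_sdiff]
      exact ⟨hA.1.1 hz, fun hzW => h z hzW hz⟩
  refine (Finset.card_le_card hsub).trans ((Finset.card_union_le _ _).trans ?_)
  refine Nat.add_le_add_left ?_ _
  apply Finset.card_biUnion_le_card_mul
  intro w _
  refine Finset.card_image_le.trans ?_
  rw [Finset.card_powersetCard, Finset.card_univ, Fintype.card_fin]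
  exact Nat.choose_le_pow _ _

lemma sum_linkDeg {n k : ℕ} (hk : 1 ≤ k) {H : Finset (Finset (Fin n))} (hH : IsKGraph n k H)
    {x : ℝ} (hx : MinDegreeGe n k H x) (U : Finset (Fin n)) :
    x * (U.card.choose (k - 1) : ℝ) ≤ ((∑ v, linkDeg H k U v : ℕ) : ℝ) := by
  have h1 : ∑ v, linkDeg H k U v =
      ∑ A ∈ U.powersetCard (k - 1),
        ((Finset.univ : Finset (Fin n)).filter (fun v => v ∉ A ∧ insert v A ∈ H)).card := by
    exact Finset.sum_card_bipartiteAbove_eq_sum_card_bipartiteBelow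
      (fun (v : Fin n) (A : Finset (Fin n)) => v ∉ A ∧ insert v A ∈ H)
  rw [h1]
  push_cast
  have h2 : ∀ A ∈ U.powersetCard (k - 1), x ≤
      ((((Finset.univ : Finset (Fin n)).filter (fun v => v ∉ A ∧ insert v A ∈ H)).card : ℕ) : ℝ) := by
    intro A hA
    rw [Finset.mem_powersetCard] at hA
    refine (hx A hA.2).trans ?_
    norm_cast
    unfold degree
    have : H.filter (fun e => A ⊆ e) ⊆
        ((Finset.univ : Finset (Fin n)).filter (fun v => v ∉ A ∧ insert v A ∈ H)).image
          (fun v => insert v A) := by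
      intro e he
      rw [Finset.mem_filter] at he
      have hc : (e \ A).card = 1 := by
        have := Finset.card_sdiff_add_card_eq_card he.2
        have := hH e he.1
        omega
      obtain ⟨y, hy⟩ := Finset.card_eq_one.mp hc
      have hye : insert y A = e := by
        rw [Finset.insert_eq, ← hy, Finset.sdiff_union_of_subset he.2]
      have hyf : y ∈ e \ A := by rw [hy]; simp
      rw [Finset.mem_image]
      refine ⟨y, ?_, hye⟩
      simp only [Finset.mem_filter, Finset.mem_univ, true_and]
      exact ⟨(Finset.mem_sdiff.mp hyf).2, hye ▸ he.1⟩
    exact (Finset.card_le_card this).trans Finset.card_image_le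
  have h3 := Finset.card_nsmul_le_sum _ _ _ h2
  rw [Finset.card_powersetCard, nsmul_eq_mul] at h3
  linarith

/-- `P` is the vertex set of an `ℓ`-path in `H` on `L` vertices. -/
def IsPathSet (k ℓ L : ℕ) {n : ℕ} (H : Finset (Finset (Fin n))) (P : Finset (Fin n)) : Prop :=
  ∃ v : ℕ → Fin n, IsPathSeq k ℓ L (· ∈ H) v ∧ (Finset.range L).image v = P

lemma IsPathSet.card {k ℓ L n : ℕ} {H : Finset (Finset (Fin n))} {P : Finset (Fin n)}
    (h : IsPathSet k ℓ L H P) : P.card = L := by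
  obtain ⟨v, hv, rfl⟩ := h
  rw [Finset.card_image_of_injOn, Finset.card_range]
  intro i hi j hj
  exact hv.2.2.1 (by simpa using hi) (by simpa using hj)

lemma single_path {n k ℓ J : ℕ} (hl0 : 0 < ℓ) (hl : ℓ < k)
    {H : Finset (Finset (Fin n))} (hH : IsKGraph n k H) (S U : Finset (Fin n))
    (hSU : Disjoint S U)
    (hbig : (J * (k - ℓ) + k) * n ^ (k - 1) < ∑ v ∈ S, linkDeg H k U v) :
    ∃ P, IsPathSet k ℓ (J * (k - ℓ) + k) H P ∧ P ⊆ S ∪ U ∧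
      ((k - 1) / (k - ℓ) + 1) * (k - ℓ) * (P ∩ S).card ≤
        J * (k - ℓ) + k + ((k - 1) / (k - ℓ) + 1) * (k - ℓ) := by
  set E := H.filter (fun e => (e ∩ S).card = 1 ∧ e ⊆ S ∪ U) with hE
  have hEk : ∀ e ∈ E, e.card = k := fun e he => hH e (Finset.mem_filter.mp he).1
  have hEcard : ∑ v ∈ S, linkDeg H k U v ≤ E.card := by
    unfold linkDeg
    rw [← Finset.card_sigma]
    apply Finset.card_le_card_of_injOn (fun p => insert p.1 p.2)
    · rintro ⟨v, A⟩ hp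
      simp only [Finset.coe_sigma, Set.mem_sigma_iff, Finset.mem_coe, Finset.mem_filter,
        Finset.mem_powersetCard] at hp
      obtain ⟨hv, ⟨hAU, hA⟩, hvA, hin⟩ := hp
      simp only [hE, Finset.coe_filter, Set.mem_ofPred_eq]
      have : insert v A ∩ S = {v} := by
        ext z
        simp only [Finset.mem_inter, Finset.mem_insert, Finset.mem_singleton]
        constructor
        · rintro ⟨h | h, hz⟩
          · exact h
          · exact absurd (hAU h) (Finset.disjoint_left.mp hSU hz)
        · rintro rfl; exact ⟨Or.inl rfl, hv⟩
      refine ⟨hin, by rw [this]; simp, ?_⟩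
      intro z hz
      rw [Finset.mem_insert] at hz
      rw [Finset.mem_union]
      rcases hz with rfl | hz
      · left; exact hv
      · right; exact hAU hz
    · rintro ⟨v, A⟩ hp ⟨v', A'⟩ hp' heq
      simp only [Finset.coe_sigma, Set.mem_sigma_iff, Finset.mem_coe, Finset.mem_filter,
        Finset.mem_powersetCard] at hp hp'
      obtain ⟨hv, ⟨hAU, hA⟩, hvA, hin⟩ := hp
      obtain ⟨hv', ⟨hAU', hA'⟩, hvA', hin'⟩ := hp'
      simp only at heq
      have hvv : v = v' := by
        have : v ∈ insert v' A' := by rw [← heq]; simp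
        rw [Finset.mem_insert] at this
        rcases this with h | h
        · exact h
        · exact absurd (hAU' h) (Finset.disjoint_left.mp hSU hv)
      subst hvv
      have : A = A' := by
        rw [← Finset.erase_insert hvA, heq, Finset.erase_insert hvA']
      subst this
      rfl
  have hsh : E.shadow.card ≤ n ^ (k - 1) := by
    have h1 : (E : Set (Finset (Fin n))).Sized k := fun e he => hEk e he
    have h2 := h1.shadow.card_le
    rw [Fintype.card_fin] at h2
    exact h2.trans (Nat.choose_le_pow _ _)
  obtain ⟨F, hFE, hne, hdeg⟩ := exists_core (J * (k - ℓ) + k) E.card E rfl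
    (lt_of_le_of_lt (Nat.mul_le_mul_left _ hsh) (lt_of_lt_of_le hbig hEcard))
  obtain ⟨v, hv1, hv2, hv3, c, hc1, hc2, hc3, hc4⟩ := exists_path hl
    (fun e he => hEk e (hFE he)) hne hdeg S (S ∪ U)
    (fun e he => (Finset.mem_filter.mp (hFE he)).2.1)
    (fun e he => (Finset.mem_filter.mp (hFE he)).2.2) hl0 J le_rfl
  refine ⟨_, ⟨v, ⟨by omega, ⟨J, ?_⟩, hv1, ?_⟩, rfl⟩, ?_, ?_⟩
  · rw [Nat.add_sub_cancel, mul_comm]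
  · intro s hs
    have : s ≤ J := by
      have h1 : s * (k - ℓ) ≤ J * (k - ℓ) := by omega
      exact Nat.le_of_mul_le_mul_right h1 (by omega)
    exact (Finset.mem_filter.mp (hFE (hv2 s this))).1
  · intro z hz
    obtain ⟨p, hp, rfl⟩ := Finset.mem_image.mp hz
    exact hv3 p (Finset.mem_range.mp hp)
  · set a := ((k - 1) / (k - ℓ) + 1) * (k - ℓ)
    calc a * _ ≤ a * (c + 1) := Nat.mul_le_mul_left _ hc4
      _ = c * a + a := by ring
      _ ≤ _ := by omega

lemma many_paths {n k ℓ J : ℕ} (hl0 : 0 < ℓ) (hl : ℓ < k)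
    {H : Finset (Finset (Fin n))} (hH : IsKGraph n k H) (S U : Finset (Fin n))
    (hSU : Disjoint S U) (L a b m : ℕ) (hL : L = J * (k - ℓ) + k)
    (ha : a = ((k - 1) / (k - ℓ) + 1) * (k - ℓ)) (hb : b = L / a + 1)
    (hbig : m * b * U.card.choose (k - 1) + S.card * (m * L * n ^ (k - 2)) + L * n ^ (k - 1) <
      ∑ v ∈ S, linkDeg H k U v) (i : ℕ) : i ≤ m + 1 →
    ∃ Q : Finset (Finset (Fin n)), Q.card = i ∧ (Q : Set (Finset (Fin n))).PairwiseDisjoint id ∧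
      ∀ P ∈ Q, IsPathSet k ℓ L H P ∧ P ⊆ S ∪ U ∧ (P ∩ S).card ≤ b := by
  induction i with
  | zero => intro _; exact ⟨∅, by simp⟩
  | succ i ih =>
    intro hi
    obtain ⟨Q, hQc, hQd, hQ⟩ := ih (by omega)
    set W := Q.biUnion id with hW
    have hWc : W.card ≤ m * L := by
      refine (Finset.card_biUnion_le_card_mul Q id L
        (fun P hP => ((hQ P hP).1.card).le)).trans ?_
      rw [hQc]; exact Nat.mul_le_mul_right _ (by omega)
    have hWS : (S ∩ W).card ≤ m * b := by
      have : S ∩ W ⊆ Q.biUnion (fun P => P ∩ S) := by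
        intro z hz
        rw [Finset.mem_inter, hW, Finset.mem_biUnion] at hz
        obtain ⟨hzS, P, hP, hzP⟩ := hz
        rw [Finset.mem_biUnion]
        exact ⟨P, hP, by simpa [hzS] using hzP⟩
      refine (Finset.card_le_card this).trans ?_
      refine (Finset.card_biUnion_le_card_mul Q _ b (fun P hP => (hQ P hP).2.2)).trans ?_
      rw [hQc]; exact Nat.mul_le_mul_right _ (by omega)
    have hsum : ∑ v ∈ S, linkDeg H k U v ≤
        m * b * U.card.choose (k - 1) + S.card * (m * L * n ^ (k - 2)) +
          ∑ v ∈ S \ W, linkDeg H k (U \ W) v := by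
      rw [← Finset.sum_inter_add_sum_sdiff S W]
      have h1 : ∑ v ∈ S ∩ W, linkDeg H k U v ≤ m * b * U.card.choose (k - 1) := by
        refine (Finset.sum_le_card_nsmul _ _ _ (fun v _ => linkDeg_le H k U v)).trans ?_
        rw [smul_eq_mul]
        exact Nat.mul_le_mul_right _ hWS
      have h2 : ∑ v ∈ S \ W, linkDeg H k U v ≤
          S.card * (m * L * n ^ (k - 2)) + ∑ v ∈ S \ W, linkDeg H k (U \ W) v := by
        have h3 : ∑ v ∈ S \ W, linkDeg H k U v ≤
            ∑ v ∈ S \ W, (m * L * n ^ (k - 2) + linkDeg H k (U \ W) v) := by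
          apply Finset.sum_le_sum
          intro v _
          have h4 := linkDeg_sdiff H k (by omega) U W v
          have h5 := Nat.mul_le_mul_right (n ^ (k - 2)) hWc
          omega
        rw [Finset.sum_add_distrib, Finset.sum_const, smul_eq_mul] at h3
        have h6 : (S \ W).card * (m * L * n ^ (k - 2)) ≤ S.card * (m * L * n ^ (k - 2)) :=
          Nat.mul_le_mul_right _ (Finset.card_le_card Finset.sdiff_subset)
        omega
      omega
    obtain ⟨P, hP1, hP2, hP3⟩ := single_path (J := J) hl0 hl hH (S \ W) (U \ W)
      (Finset.disjoint_of_subset_left Finset.sdiff_subset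
        (Finset.disjoint_of_subset_right Finset.sdiff_subset hSU)) (by rw [← hL]; omega)
    rw [← hL] at hP1
    rw [← hL, ← ha] at hP3
    have hPW : Disjoint P W := by
      rw [Finset.disjoint_left]
      intro z hz hzW
      have := hP2 hz
      simp only [Finset.mem_union, Finset.mem_sdiff] at this
      tauto
    have hPne : P.Nonempty := Finset.card_pos.mp (by rw [hP1.card, hL]; omega)
    have hPQ : P ∉ Q := by
      intro h
      obtain ⟨z, hz⟩ := hPne
      exact Finset.disjoint_left.mp hPW hz (Finset.mem_biUnion.mpr ⟨P, h, hz⟩)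
    have ha0 : 0 < a := by rw [ha]; exact Nat.mul_pos (Nat.succ_pos _) (by omega)
    refine ⟨insert P Q, ?_, ?_, ?_⟩
    · rw [Finset.card_insert_of_notMem hPQ, hQc]
    · rw [Finset.coe_insert]
      apply hQd.insert
      intro P' hP' _
      exact Finset.disjoint_of_subset_right (Finset.subset_biUnion_of_mem id hP') hPW
    · intro P' hP'
      rw [Finset.mem_insert] at hP'
      rcases hP' with rfl | hP'
      · refine ⟨hP1, hP2.trans (Finset.union_subset_union Finset.sdiff_subset
          Finset.sdiff_subset), ?_⟩
        have h1 : P' ∩ S ⊆ P' ∩ (S \ W) := by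
          intro z hz
          rw [Finset.mem_inter] at hz
          simp only [Finset.mem_inter, Finset.mem_sdiff]
          exact ⟨hz.1, hz.2, Finset.disjoint_left.mp hPW hz.1⟩
        refine (Finset.card_le_card h1).trans ?_
        rw [hb, ← Nat.add_div_right _ ha0, Nat.le_div_iff_mul_le ha0]
        rw [mul_comm]; exact hP3
      · exact hQ P' hP'

lemma exists_heavy {ι : Type*} [DecidableEq ι] (f : ι → ℝ) (c : ℝ) (m : ℕ) (s : Finset ι) :
    m ≤ s.card → c * s.card ≤ ∑ i ∈ s, f i →
    ∃ T ⊆ s, T.card = m ∧ c * m ≤ ∑ i ∈ T, f i := by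
  induction s using Finset.strongInduction with
  | H s ih =>
    intro hm hs
    rcases Nat.eq_or_lt_of_le hm with h | h
    · exact ⟨s, Finset.Subset.refl _, h.symm, by rw [h]; exact hs⟩
    · by_cases hx : ∃ x ∈ s, f x ≤ c
      · obtain ⟨x, hxs, hxc⟩ := hx
        have hcard := Finset.card_erase_of_mem hxs
        have hcard' : ((s.erase x).card : ℝ) = s.card - 1 := by
          rw [hcard, Nat.cast_sub (by omega)]; simp
        obtain ⟨T, hT, h1⟩ := ih (s.erase x) (Finset.erase_ssubset hxs) (by omega) (by
          have := Finset.add_sum_erase s f hxs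
          rw [hcard']
          linarith)
        exact ⟨T, hT.trans (Finset.erase_subset _ _), h1⟩
      · push Not at hx
        obtain ⟨T, hT, hTc⟩ := Finset.exists_subset_card_eq hm
        refine ⟨T, hT, hTc, ?_⟩
        have := Finset.card_nsmul_le_sum T f c (fun x hx' => (hx x (hT hx')).le)
        rw [nsmul_eq_mul, hTc] at this
        linarith

set_option maxHeartbeats 1000000 in
/-- The extremal argument: a maximum family of disjoint `L`-vertex paths leaves few vertices. -/
lemma max_family_covers {n k ℓ J : ℕ} (hk : 3 ≤ k) (hl0 : 0 < ℓ) (hl : ℓ < k)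
    {H : Finset (Finset (Fin n))} (hH : IsKGraph n k H) (L a m : ℕ)
    (hL : L = J * (k - ℓ) + k)
    (ha : a = ((k - 1) / (k - ℓ) + 1) * (k - ℓ))
    (μ ε γ : ℝ) (hμ : 0 < μ) (hε : 0 < ε) (hγ : 0 < γ) (hn : 0 < n)
    (hdeg : MinDegreeGe n k H ((1 / (a : ℝ) + μ) * n))
    (hNγ : ∀ u : ℕ, ε * n ≤ u → γ * (n : ℝ) ^ (k - 1) ≤ (u.choose (k - 1) : ℝ))
    (hm1 : 8 ≤ μ * γ * m) (hm2 : 1 ≤ ε * m) (hm3 : 1 ≤ μ * m) (hmL : 2 * m ^ 2 * L ≤ n)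
    (hLμ : 4 ≤ μ * L)
    (Q : Finset (Finset (Fin n))) (hQd : (Q : Set (Finset (Fin n))).PairwiseDisjoint id)
    (hQ : ∀ P ∈ Q, IsPathSet k ℓ L H P)
    (hmax : ∀ Q' : Finset (Finset (Fin n)), (Q' : Set (Finset (Fin n))).PairwiseDisjoint id →
      (∀ P ∈ Q', IsPathSet k ℓ L H P) → Q'.card ≤ Q.card) :
    (n : ℝ) - ε * n ≤ ((Q.biUnion id).card : ℝ) := by
  by_contra hcon
  push Not at hcon
  set C := Q.biUnion id with hC
  set U := (Finset.univ : Finset (Fin n)) \ C with hU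
  have hUc : (U.card : ℝ) = n - C.card := by
    have := Finset.card_sdiff_add_card_eq_card (Finset.subset_univ C)
    rw [Finset.card_univ, Fintype.card_fin] at this
    have h2 : (U.card : ℝ) + C.card = n := by exact_mod_cast this
    linarith
  have hUε : ε * n ≤ U.card := by rw [hUc]; linarith
  have hUn : (U.card : ℝ) ≤ n := by
    rw [hUc]
    have : (0 : ℝ) ≤ C.card := Nat.cast_nonneg _
    linarith
  have hn' : (0 : ℝ) < n := by exact_mod_cast hn
  set N := U.card.choose (k - 1) with hN
  have hNlow : γ * (n : ℝ) ^ (k - 1) ≤ (N : ℝ) := hNγ _ hUε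
  have hnk : (0 : ℝ) < (n : ℝ) ^ (k - 1) := by positivity
  have hNpos : (0 : ℝ) < N := lt_of_lt_of_le (by positivity) hNlow
  have hL0 : 0 < L := by omega
  have hLr : (0 : ℝ) < L := by exact_mod_cast hL0
  have hm0 : 0 < m := by
    rcases Nat.eq_zero_or_pos m with h | h
    · rw [h] at hm2; norm_num at hm2
    · exact h
  have hmr : (0 : ℝ) < m := by exact_mod_cast hm0
  have ha0 : 0 < a := by rw [ha]; exact Nat.mul_pos (Nat.succ_pos _) (by omega)
  have har : (0 : ℝ) < a := by exact_mod_cast ha0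
  have hmLr : 2 * (m : ℝ) ^ 2 * L ≤ n := by exact_mod_cast hmL
  have hpow : (n : ℝ) ^ (k - 1) = n * (n : ℝ) ^ (k - 2) := by
    rw [← pow_succ']; congr 1; omega
  have hnk2 : (0 : ℝ) < (n : ℝ) ^ (k - 2) := by positivity
  -- loss term
  have hloss : ((m : ℝ) * L) * (m * L * (n : ℝ) ^ (k - 2)) < L * (n : ℝ) ^ (k - 1) := by
    rw [hpow]
    have h1 : (m : ℝ) ^ 2 * L < n := by
      have : 0 < (m : ℝ) ^ 2 * L := by positivity
      linarith
    calc ((m : ℝ) * L) * (m * L * (n : ℝ) ^ (k - 2))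
        = (L * (n : ℝ) ^ (k - 2)) * ((m : ℝ) ^ 2 * L) := by ring
      _ < (L * (n : ℝ) ^ (k - 2)) * n := by
          apply mul_lt_mul_of_pos_left h1; positivity
      _ = _ := by ring
  -- gain term
  have hgain : 8 * (L * (n : ℝ) ^ (k - 1)) ≤ μ * N * (m * L) := by
    calc 8 * (L * (n : ℝ) ^ (k - 1)) ≤ (μ * γ * m) * (L * (n : ℝ) ^ (k - 1)) := by
          apply mul_le_mul_of_nonneg_right hm1; positivity
      _ = (μ * m * L) * (γ * (n : ℝ) ^ (k - 1)) := by ring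
      _ ≤ (μ * m * L) * N := by
          apply mul_le_mul_of_nonneg_left hNlow; positivity
      _ = _ := by ring
  have hLn : 0 < (L : ℝ) * (n : ℝ) ^ (k - 1) := by positivity
  have htot := sum_linkDeg (by omega) hH hdeg U
  rw [← hN] at htot
  have hsplit : ((∑ v, linkDeg H k U v : ℕ) : ℝ) =
      (∑ v ∈ U, (linkDeg H k U v : ℝ)) + ∑ v ∈ C, (linkDeg H k U v : ℝ) := by
    push_cast
    rw [hU, Finset.sum_sdiff (Finset.subset_univ C)]
  by_cases hcase : μ / 2 * n * N ≤ ∑ v ∈ U, (linkDeg H k U v : ℝ)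
  · -- many edges inside `U`
    have hmU : m * L ≤ U.card := by
      have h1 : (m : ℝ) * L ≤ ε * n := by
        have h2 : (m : ℝ) * L * 1 ≤ (m : ℝ) * L * (ε * m) :=
          mul_le_mul_of_nonneg_left hm2 (by positivity)
        have h3 : ε * (2 * (m : ℝ) ^ 2 * L) ≤ ε * n := mul_le_mul_of_nonneg_left hmLr hε.le
        have h4 : 0 ≤ ε * ((m : ℝ) ^ 2 * L) := by positivity
        have h5 : (m : ℝ) * L * (ε * m) = ε * ((m : ℝ) ^ 2 * L) := by ring
        have h6 : ε * (2 * (m : ℝ) ^ 2 * L) = 2 * (ε * ((m : ℝ) ^ 2 * L)) := by ring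
        linarith
      exact_mod_cast h1.trans hUε
    obtain ⟨S, hSU, hSc, hS⟩ := exists_heavy (fun v => (linkDeg H k U v : ℝ)) (μ / 2 * N) (m * L) U
      hmU (by
        refine le_trans ?_ hcase
        have : μ / 2 * N * U.card ≤ μ / 2 * N * n :=
          mul_le_mul_of_nonneg_left hUn (by positivity)
        linarith)
    have hsum : ∑ v ∈ S, linkDeg H k U v ≤
        (m * L) * (m * L * n ^ (k - 2)) + ∑ v ∈ S, linkDeg H k (U \ S) v := by
      have h3 : ∑ v ∈ S, linkDeg H k U v ≤
          ∑ v ∈ S, (m * L * n ^ (k - 2) + linkDeg H k (U \ S) v) := by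
        apply Finset.sum_le_sum
        intro v _
        have h4 := linkDeg_sdiff H k (by omega) U S v
        rw [hSc] at h4
        omega
      rw [Finset.sum_add_distrib, Finset.sum_const, smul_eq_mul, hSc] at h3
      exact h3
    have hbig : L * n ^ (k - 1) < ∑ v ∈ S, linkDeg H k (U \ S) v := by
      have h5 : ((∑ v ∈ S, linkDeg H k U v : ℕ) : ℝ) ≤
        (m * L) * (m * L * (n : ℝ) ^ (k - 2)) + ((∑ v ∈ S, linkDeg H k (U \ S) v : ℕ) : ℝ) := by
        exact_mod_cast hsum
      have h6 : (L : ℝ) * (n : ℝ) ^ (k - 1) < ((∑ v ∈ S, linkDeg H k (U \ S) v : ℕ) : ℝ) := by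
        push_cast at h5 hS ⊢
        linarith
      exact_mod_cast h6
    obtain ⟨P, hP1, hP2, -⟩ := single_path (J := J) hl0 hl hH S (U \ S)
      Finset.disjoint_sdiff (by rw [← hL]; exact hbig)
    rw [← hL] at hP1
    have hPU : P ⊆ U := by
      intro z hz
      have := hP2 hz
      rw [Finset.mem_union, Finset.mem_sdiff] at this
      rcases this with h | h
      · exact hSU h
      · exact h.1
    have hPC : Disjoint P C := by
      rw [Finset.disjoint_left]
      intro z hz
      exact (Finset.mem_sdiff.mp (hPU hz)).2
    have hPQ : P ∉ Q := by
      intro h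
      obtain ⟨z, hz⟩ := Finset.card_pos.mp (by rw [hP1.card]; exact hL0 : 0 < P.card)
      exact Finset.disjoint_left.mp hPC hz (Finset.mem_biUnion.mpr ⟨P, h, hz⟩)
    have := hmax (insert P Q) (by
      rw [Finset.coe_insert]
      apply hQd.insert
      intro P' hP' _
      exact Finset.disjoint_of_subset_right (Finset.subset_biUnion_of_mem id hP') hPC) (by
      intro P' hP'
      rw [Finset.mem_insert] at hP'
      rcases hP' with rfl | hP'
      · exact hP1
      · exact hQ P' hP')
    rw [Finset.card_insert_of_notMem hPQ] at this
    omega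
  · push Not at hcase
    have hCsum : (1 / (a : ℝ) + μ / 2) * n * N ≤ ∑ v ∈ C, (linkDeg H k U v : ℝ) := by
      rw [hsplit] at htot
      have : (1 / (a : ℝ) + μ) * n * N = (1 / (a : ℝ) + μ / 2) * n * N + μ / 2 * n * N := by ring
      linarith
    have hCQ : ∑ v ∈ C, (linkDeg H k U v : ℝ) =
        ∑ P ∈ Q, ∑ v ∈ P, (linkDeg H k U v : ℝ) := by
      rw [hC, Finset.sum_biUnion hQd]; rfl
    have hQL : C.card = Q.card * L := by
      rw [hC, Finset.card_biUnion hQd]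
      exact Finset.sum_const_nat (fun P hP => (hQ P hP).card)
    have hCn : (Q.card : ℝ) * L ≤ n := by
      have h1 : C.card ≤ n := by
        have := Finset.card_le_univ C
        rwa [Fintype.card_fin] at this
      rw [hQL] at h1
      exact_mod_cast h1
    have hainv : 0 < 1 / (a : ℝ) := by positivity
    have hQm : m ≤ Q.card := by
      have h1 : ∑ v ∈ C, (linkDeg H k U v : ℝ) ≤ Q.card * L * N := by
        have h2 := Finset.sum_le_card_nsmul C (fun v => (linkDeg H k U v : ℝ)) N
          (fun v _ => by exact_mod_cast linkDeg_le H k U v)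
        rw [nsmul_eq_mul, hQL] at h2
        push_cast at h2
        exact h2
      have h3 : μ / 2 * n * N ≤ Q.card * L * N := by
        have h9 : 0 ≤ 1 / (a : ℝ) * n * N := by positivity
        have h10 : (1 / (a : ℝ) + μ / 2) * n * N = 1 / (a : ℝ) * n * N + μ / 2 * n * N := by ring
        linarith
      have h4 : μ / 2 * n ≤ Q.card * L := le_of_mul_le_mul_right h3 hNpos
      have h5 : μ / 2 * (2 * (m : ℝ) ^ 2 * L) ≤ μ / 2 * n :=
        mul_le_mul_of_nonneg_left hmLr (by positivity)
      have h6 : (μ * (m : ℝ) ^ 2) * L ≤ Q.card * L := by linarith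
      have h7 : μ * (m : ℝ) ^ 2 ≤ Q.card := le_of_mul_le_mul_right h6 hLr
      have h8 : (m : ℝ) ≤ μ * (m : ℝ) ^ 2 := by
        calc (m : ℝ) = 1 * m := by ring
          _ ≤ (μ * m) * m := mul_le_mul_of_nonneg_right hm3 hmr.le
          _ = _ := by ring
      exact_mod_cast h8.trans h7
    obtain ⟨T, hTQ, hTc, hT⟩ := exists_heavy (fun P => ∑ v ∈ P, (linkDeg H k U v : ℝ))
      ((1 / (a : ℝ) + μ / 2) * N * L) m Q hQm (by
        rw [← hCQ]
        refine le_trans ?_ hCsum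
        calc (1 / (a : ℝ) + μ / 2) * N * L * Q.card
            = ((1 / (a : ℝ) + μ / 2) * N) * (Q.card * L) := by ring
          _ ≤ ((1 / (a : ℝ) + μ / 2) * N) * n :=
              mul_le_mul_of_nonneg_left hCn (by positivity)
          _ = _ := by ring)
    set S := T.biUnion id with hS
    have hTd : (T : Set (Finset (Fin n))).PairwiseDisjoint id :=
      hQd.subset (by exact_mod_cast hTQ)
    have hSc : S.card = m * L := by
      rw [hS, Finset.card_biUnion hTd, ← hTc]
      exact Finset.sum_const_nat (fun P hP => (hQ P (hTQ hP)).card)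
    have hSsum : (1 / (a : ℝ) + μ / 2) * N * L * m ≤ ∑ v ∈ S, (linkDeg H k U v : ℝ) := by
      rw [hS, Finset.sum_biUnion hTd]; exact hT
    have hSC : S ⊆ C := Finset.biUnion_subset_biUnion_of_subset_left _ hTQ
    have hSU : Disjoint S U := Finset.disjoint_of_subset_left hSC Finset.disjoint_sdiff
    have hb : ((L / a + 1 : ℕ) : ℝ) ≤ L / a + 1 := by
      push_cast
      have := @Nat.cast_div_le ℝ _ _ _ L a
      linarith
    have hbig : m * (L / a + 1) * N + S.card * (m * L * n ^ (k - 2)) + L * n ^ (k - 1) <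
        ∑ v ∈ S, linkDeg H k U v := by
      rw [hSc]
      have h1 : (m : ℝ) * ((L / a + 1 : ℕ) : ℝ) * N + (m * L) * (m * L * (n : ℝ) ^ (k - 2))
          + L * (n : ℝ) ^ (k - 1) < ∑ v ∈ S, (linkDeg H k U v : ℝ) := by
        have h2 : (m : ℝ) * ((L / a + 1 : ℕ) : ℝ) * N ≤ m * ((L : ℝ) / a + 1) * N := by
          gcongr
        have h3 : m * ((L : ℝ) / a + 1) * N = 1 / (a : ℝ) * N * L * m + m * N := by
          field_simp
        have h4 : (m : ℝ) * N * 4 ≤ m * N * (μ * L) :=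
          mul_le_mul_of_nonneg_left hLμ (by positivity)
        have h5 : (1 / (a : ℝ) + μ / 2) * N * L * m =
          1 / (a : ℝ) * N * L * m + (μ * N * (m * L)) / 2 := by ring
        have h6 : (m : ℝ) * N * (μ * L) = μ * N * (m * L) := by ring
        linarith
      exact_mod_cast h1
    obtain ⟨R, hRc, hRd, hR⟩ := many_paths (J := J) hl0 hl hH S U hSU L a (L / a + 1) m hL ha rfl
      hbig (m + 1) le_rfl
    have hdisj : ∀ P ∈ R, ∀ P' ∈ Q \ T, Disjoint P P' := by
      intro P hP P' hP'
      rw [Finset.mem_sdiff] at hP'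
      rw [Finset.disjoint_left]
      intro z hz hz'
      have h1 := (hR P hP).2.1 hz
      rw [Finset.mem_union] at h1
      rcases h1 with h1 | h1
      · rw [hS, Finset.mem_biUnion] at h1
        obtain ⟨P'', hP'', hzP⟩ := h1
        have hne : P'' ≠ P' := fun h => hP'.2 (h ▸ hP'')
        exact Finset.disjoint_left.mp (hQd (hTQ hP'') hP'.1 hne) hzP hz'
      · exact (Finset.mem_sdiff.mp h1).2 (Finset.mem_biUnion.mpr ⟨P', hP'.1, hz'⟩)
    have hRQ : Disjoint R (Q \ T) := by
      rw [Finset.disjoint_left]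
      intro P hP hP'
      have h1 := hdisj P hP P hP'
      rw [Finset.disjoint_self_iff_empty] at h1
      have h2 := (hR P hP).1.card
      rw [h1, Finset.card_empty] at h2
      omega
    have := hmax (R ∪ (Q \ T)) (by
      rw [Finset.coe_union]
      apply Set.PairwiseDisjoint.union hRd
      · exact hQd.subset (by exact_mod_cast Finset.sdiff_subset)
      · intro P hP P' hP' _
        exact hdisj P hP P' hP') (by
      intro P hP
      rw [Finset.mem_union] at hP
      rcases hP with hP | hP
      · exact (hR P hP).1
      · exact hQ P (Finset.mem_sdiff.mp hP).1)
    rw [Finset.card_union_of_disjoint hRQ, hRc, Finset.card_sdiff_of_subset hTQ, hTc] at this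
    omega

/-- Path cover lemma: a `k`-graph of minimum degree at least
`(1/(⌈k/(k-ℓ)⌉(k-ℓ)) + μ) n` contains at most `D` disjoint `ℓ`-paths covering
all but at most `εn` vertices. -/
theorem path_cover_lemma
    (k ℓ : ℕ) (hk : 3 ≤ k) (hl1 : 1 ≤ ℓ) (hl2 : ℓ ≤ k - 1)
    (μ ε : ℝ) (hμ : 0 < μ) (hε : 0 < ε) (hεμ : ε < μ) :
    ∃ (D n₀ : ℕ), ∀ n ≥ n₀,
      ∀ H : Finset (Finset (Fin n)), IsKGraph n k H →
        MinDegreeGe n k H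
          ((1 / ((ceilQuot k (k - ℓ) * (k - ℓ) : ℕ) : ℝ) + μ) * n) →
        ∃ (q : ℕ) (r : Fin q → ℕ) (v : Fin q → ℕ → Fin n),
          q ≤ D ∧
          (∀ p, IsPathSeq k ℓ (r p) (· ∈ H) (v p)) ∧
          (∀ p p', p ≠ p' → ∀ i < r p, ∀ j < r p', v p i ≠ v p' j) ∧
          ((n : ℝ) - ε * n ≤
            ((Finset.univ.biUnion
                (fun p => (Finset.range (r p)).image (v p))).card : ℝ)) := by
  have hr0 : 0 < k - ℓ := by omega
  have hceil : ceilQuot k (k - ℓ) = (k - 1) / (k - ℓ) + 1 := by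
    unfold ceilQuot
    rw [← Nat.add_div_right _ hr0]
    congr 1; omega
  rw [hceil]
  set a := ((k - 1) / (k - ℓ) + 1) * (k - ℓ) with ha
  set γ : ℝ := (ε / 2) ^ (k - 1) / ((k - 1).factorial : ℝ) with hγ
  have hγ0 : 0 < γ := by positivity
  obtain ⟨m, hm⟩ := exists_nat_ge (8 / (μ * γ) + 1 / ε + 1 / μ + 1)
  have hp1 : 0 < 8 / (μ * γ) := by positivity
  have hp2 : 0 < 1 / ε := by positivity
  have hp3 : 0 < 1 / μ := by positivity
  have hm1 : 8 ≤ μ * γ * m := by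
    have : 8 / (μ * γ) ≤ m := by linarith
    rw [div_le_iff₀ (by positivity)] at this
    linarith
  have hm2 : 1 ≤ ε * m := by
    have : 1 / ε ≤ m := by linarith
    rw [div_le_iff₀ (by positivity)] at this
    linarith
  have hm3 : 1 ≤ μ * m := by
    have : 1 / μ ≤ m := by linarith
    rw [div_le_iff₀ (by positivity)] at this
    linarith
  have hm0 : 0 < m := by
    have : (1 : ℝ) ≤ m := by linarith
    exact_mod_cast this
  set M := 4 * m ^ 2 * (k - ℓ) with hM
  have hM0 : 0 < M := by positivity
  obtain ⟨A, hA⟩ := exists_nat_ge (4 / μ)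
  obtain ⟨B, hB⟩ := exists_nat_ge (2 * k / ε)
  refine ⟨M, M * A + B + 4 * m ^ 2 * k + 1, ?_⟩
  intro n hn H hH hdeg
  set J := n / M with hJ
  set L := J * (k - ℓ) + k with hL
  have hn0 : 0 < n := by omega
  have hAJ : A ≤ J := by
    rw [hJ, Nat.le_div_iff_mul_le hM0, mul_comm]; omega
  have hJL : J + 1 ≤ L := by
    have : J * 1 ≤ J * (k - ℓ) := Nat.mul_le_mul_left _ hr0
    omega
  have hLμ : 4 ≤ μ * L := by
    have h1 : (A : ℝ) ≤ L := by exact_mod_cast (by omega : A ≤ L)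
    have h2 : 4 / μ ≤ L := hA.trans h1
    rw [div_le_iff₀ hμ] at h2
    linarith
  have hmL : 2 * m ^ 2 * L ≤ n := by
    have h1 : J * M ≤ n := Nat.div_mul_le_self n M
    have h2 : 2 * (2 * m ^ 2 * L) = J * M + 4 * m ^ 2 * k := by rw [hL, hM]; ring
    omega
  have hNγ : ∀ u : ℕ, ε * n ≤ u → γ * (n : ℝ) ^ (k - 1) ≤ (u.choose (k - 1) : ℝ) := by
    intro u hu
    refine le_trans ?_ (Nat.pow_le_choose (α := ℝ) (k - 1) u)
    rw [hγ, div_mul_eq_mul_div, ← mul_pow]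
    have hBn : (B : ℝ) ≤ n := by exact_mod_cast (by omega : B ≤ n)
    have h1 : 2 * k / ε ≤ n := hB.trans hBn
    rw [div_le_iff₀ hε] at h1
    have h2 : k ≤ u := by
      have h0 : (0 : ℝ) ≤ k := Nat.cast_nonneg _
      have : (k : ℝ) ≤ u := by linarith
      exact_mod_cast this
    have h3 : ε / 2 * n ≤ ((u + 1 - (k - 1) : ℕ) : ℝ) := by
      have h4 : u - k ≤ u + 1 - (k - 1) := by omega
      have h5 : ((u - k : ℕ) : ℝ) ≤ ((u + 1 - (k - 1) : ℕ) : ℝ) := by exact_mod_cast h4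
      rw [Nat.cast_sub h2] at h5
      linarith
    gcongr
  classical
  let fam : Finset (Finset (Finset (Fin n))) := Finset.univ.filter (fun Q =>
    (Q : Set (Finset (Fin n))).PairwiseDisjoint id ∧ ∀ P ∈ Q, IsPathSet k ℓ L H P)
  have hfam : fam.Nonempty := ⟨∅, by simp [fam]⟩
  obtain ⟨Q, hQf, hQmax⟩ := Finset.exists_max_image fam Finset.card hfam
  simp only [fam, Finset.mem_filter, Finset.mem_univ, true_and] at hQf
  obtain ⟨hQd, hQ⟩ := hQf
  have hcov := max_family_covers hk (by omega) (by omega) hH L a m hL ha μ ε γ hμ hε hγ0 hn0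
    hdeg hNγ hm1 hm2 hm3 hmL hLμ Q hQd hQ (fun Q' h1 h2 => hQmax Q' (by
      simp only [fam, Finset.mem_filter, Finset.mem_univ, true_and]
      exact ⟨h1, h2⟩))
  have hQcard : Q.card ≤ M := by
    have h1 : (Q.biUnion id).card = Q.card * L := by
      rw [Finset.card_biUnion hQd]
      exact Finset.sum_const_nat (fun P hP => (hQ P hP).card)
    have h2 : (Q.biUnion id).card ≤ n := by
      have := Finset.card_le_univ (Q.biUnion id)
      rwa [Fintype.card_fin] at this
    have h3 : n < (J + 1) * M := by
      rw [mul_comm]; exact Nat.lt_mul_div_succ n hM0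
    have h4 : Q.card * (J + 1) ≤ Q.card * L := Nat.mul_le_mul_left _ hJL
    have h5 : (J + 1) * Q.card < (J + 1) * M := by
      rw [mul_comm (J + 1) Q.card]; omega
    exact (Nat.lt_of_mul_lt_mul_left h5).le
  have hch : ∀ p : Fin Q.card, ∃ v : ℕ → Fin n, IsPathSeq k ℓ L (· ∈ H) v ∧
      (Finset.range L).image v = (Q.equivFin.symm p : Finset (Fin n)) :=
    fun p => hQ _ (Q.equivFin.symm p).2
  choose v hv1 hv2 using hch
  refine ⟨Q.card, fun _ => L, v, hQcard, hv1, ?_, ?_⟩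
  · intro p p' hpp i hi j hj heq
    have hne : (Q.equivFin.symm p : Finset (Fin n)) ≠ Q.equivFin.symm p' := by
      intro h
      exact hpp (Q.equivFin.symm.injective (Subtype.ext h))
    have hd := hQd (Q.equivFin.symm p).2 (Q.equivFin.symm p').2 hne
    simp only [Function.onFun, id] at hd
    rw [← hv2 p, ← hv2 p'] at hd
    refine Finset.disjoint_left.mp hd (Finset.mem_image_of_mem _ (Finset.mem_range.mpr hi)) ?_
    rw [heq]
    exact Finset.mem_image_of_mem _ (Finset.mem_range.mpr hj)
  · refine hcov.trans ?_
    have : Q.biUnion id ⊆ Finset.univ.biUnion (fun p => (Finset.range L).image (v p)) := by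
      intro z hz
      obtain ⟨P, hP, hzP⟩ := Finset.mem_biUnion.mp hz
      refine Finset.mem_biUnion.mpr ⟨Q.equivFin ⟨P, hP⟩, Finset.mem_univ _, ?_⟩
      rw [hv2]
      simpa using hzP
    exact_mod_cast Finset.card_le_card this
end

section
/- Suppose k ≥ 3 and 1 ≤ ℓ ≤ k−1, and set a := ⌈k/(k−ℓ)⌉(k−ℓ). For every ε > 0 there exist θ > 0 with θ < ε and an integer n₀ such that the following holds for all n ≥ n₀. Let H be a k-graph of order n such that d_H(S) ≥ n/a for all but at most θn^{k−1} sets S of k−1 vertices of H. Then H contains an F_{k,ℓ}-packing covering all but at most εn vertices of H. -/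
open Finset

/-- `a = ⌈k/(k-ℓ)⌉ (k-ℓ)`. -/
def aParam (k ℓ : ℕ) : ℕ := ceilQuot k (k - ℓ) * (k - ℓ)

/-- The vertex set of the `k`-graph `F_{k,ℓ}`: the vertices of `A_1, …, A_{a-1}`
(each of size `k-1`) together with `B` (of size `k-1`). -/
abbrev FVert (k ℓ : ℕ) := (Fin (aParam k ℓ - 1) × Fin (k - 1)) ⊕ Fin (k - 1)

/-- The edge set of `F_{k,ℓ}`: all `k`-sets of the form `A_i ∪ {b}` with `b ∈ B`. -/
def FEdges (k ℓ : ℕ) : Finset (Finset (FVert k ℓ)) :=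
  Finset.univ.image (fun p : Fin (aParam k ℓ - 1) × Fin (k - 1) =>
    (Finset.univ.filter
      (fun x : Fin (aParam k ℓ - 1) × Fin (k - 1) => x.1 = p.1)).image Sum.inl
    ∪ {Sum.inr p.2})

lemma card_noninj {τ Y : Type} [Fintype τ] [Fintype Y] [DecidableEq τ] [DecidableEq Y] :
    #{y : τ → Y | ¬ Function.Injective y} * Fintype.card Y
      ≤ Fintype.card τ ^ 2 * Fintype.card Y ^ Fintype.card τ := by
  classical
  have h1 : (univ.filter fun y : τ → Y => ¬ Function.Injective y) ⊆
      (univ : Finset (τ × τ)).biUnion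
        (fun p => univ.filter fun y : τ → Y => p.1 ≠ p.2 ∧ y p.1 = y p.2) := by
    intro y hy
    simp only [mem_filter, mem_univ, true_and, Function.Injective, not_forall] at hy
    obtain ⟨i, j, h, hne⟩ := hy
    simp only [mem_biUnion, mem_filter, mem_univ, true_and]
    exact ⟨(i, j), hne, h⟩
  have h2 : ∀ p : τ × τ, #{y : τ → Y | p.1 ≠ p.2 ∧ y p.1 = y p.2} * Fintype.card Y
      ≤ Fintype.card Y ^ Fintype.card τ := by
    intro p
    rw [← Fintype.card_fun (α := τ) (β := Y), ← Finset.card_univ (α := Y), ← card_product,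
      ← Finset.card_univ]
    refine card_le_card_of_injOn (fun q => Function.update q.1 p.1 q.2) (by simp) ?_
    rintro ⟨y, z⟩ hy ⟨y', z'⟩ hy' h
    simp only [coe_product, Set.mem_prod, mem_coe, mem_filter, mem_univ, true_and, and_true] at hy hy'
    have hz : z = z' := by simpa using congrFun h p.1
    have hj : ∀ j, j ≠ p.1 → y j = y' j := fun j hj => by
      simpa [Function.update_of_ne hj] using congrFun h j
    refine Prod.ext (funext fun j => ?_) hz
    by_cases hjp : j = p.1
    · subst hjp
      show y p.1 = y' p.1
      rw [hy.2, hy'.2]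
      exact hj _ (Ne.symm hy.1)
    · exact hj j hjp
  calc _ ≤ (∑ p : τ × τ, #{y : τ → Y | p.1 ≠ p.2 ∧ y p.1 = y p.2}) * Fintype.card Y :=
        Nat.mul_le_mul_right _ ((card_le_card h1).trans card_biUnion_le)
    _ = ∑ p : τ × τ, #{y : τ → Y | p.1 ≠ p.2 ∧ y p.1 = y p.2} * Fintype.card Y := sum_mul ..
    _ ≤ ∑ p : τ × τ, Fintype.card Y ^ Fintype.card τ := sum_le_sum fun p _ => h2 p
    _ = _ := by simp [sq]

open Classical in
lemma kst (τ : Type) [Fintype τ] (c : ℝ) (hc : 0 < c) :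
    ∃ c' : ℝ, 0 < c' ∧ ∃ N : ℕ, ∀ (Y X : Type) [Fintype Y] [Fintype X], N ≤ Fintype.card Y →
      0 < Fintype.card X → ∀ R : Y → X → Prop,
      c * (Fintype.card Y * Fintype.card X) ≤ (#{p : Y × X | R p.1 p.2} : ℝ) →
      ∃ y : τ → Y, Function.Injective y ∧
        c' * Fintype.card X ≤ (#{x : X | ∀ j, R (y j) x} : ℝ) := by
  set T := Fintype.card τ with hT
  set c' := (c / 2) ^ (T + 1) / 3 with hc'
  have hc'0 : 0 < c' := by positivity
  obtain ⟨N, hN⟩ := exists_nat_ge ((T : ℝ) ^ 2 / c')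
  refine ⟨c', hc'0, N + 1, ?_⟩
  intro Y X _ _ hY hX R hR
  by_contra hcon
  push Not at hcon
  set n : ℝ := ((Fintype.card Y : ℕ) : ℝ) with hn
  set m : ℝ := ((Fintype.card X : ℕ) : ℝ) with hm
  have hm0 : 0 < m := by rw [hm]; exact_mod_cast hX
  have hn0 : 0 < n := by rw [hn]; exact_mod_cast (by omega : 0 < Fintype.card Y)
  let d : X → ℝ := fun x => (#{y : Y | R y x} : ℝ)
  have hd_le : ∀ x, d x ≤ n := fun x => by
    show (#{y : Y | R y x} : ℝ) ≤ Fintype.card Y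
    exact_mod_cast card_le_univ _
  have hsum : (#{p : Y × X | R p.1 p.2} : ℝ) = ∑ x, d x := by
    rw [card_filter]
    push_cast
    rw [Fintype.sum_prod_type_right]
    refine sum_congr rfl fun x _ => ?_
    simp [d]
  -- many x of large degree
  set P := univ.filter fun x => c / 2 * n ≤ d x with hP
  have hPc : c / 2 * m ≤ (#P : ℝ) := by
    have : ∑ x, d x ≤ #P * n + m * (c / 2 * n) := by
      calc ∑ x, d x ≤ ∑ x, ((if x ∈ P then n else 0) + c / 2 * n) := by
            refine sum_le_sum fun x _ => ?_
            split_ifs with h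
            · have := hd_le x
              have : 0 ≤ c / 2 * n := by positivity
              linarith [hd_le x]
            · simp only [hP, mem_filter, mem_univ, true_and, not_le] at h
              linarith
        _ = _ := by
            rw [sum_add_distrib]
            simp [hm, sum_ite_mem]
    rw [hsum] at hR
    have h2 : c / 2 * m * n ≤ #P * n := by nlinarith
    exact le_of_mul_le_mul_right h2 hn0
  -- double count
  have hdc : (∑ y : τ → Y, (#{x : X | ∀ j, R (y j) x} : ℝ)) = ∑ x, d x ^ T := by
    have h1 : ∀ y : τ → Y, (#{x : X | ∀ j, R (y j) x} : ℝ)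
        = ∑ x, if ∀ j, R (y j) x then (1 : ℝ) else 0 := by intro y; simp
    simp_rw [h1]
    rw [sum_comm]
    refine sum_congr rfl fun x _ => ?_
    have : (univ.filter fun y : τ → Y => ∀ j, R (y j) x)
        = Fintype.piFinset fun _ : τ => univ.filter fun y : Y => R y x := by
      ext y; simp [Fintype.mem_piFinset]
    rw [← sum_filter, this]
    simp [d, hT]
  have hlow : c / 2 * m * (c / 2 * n) ^ T ≤ ∑ x, d x ^ T := by
    calc c / 2 * m * (c / 2 * n) ^ T ≤ #P * (c / 2 * n) ^ T := by gcongr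
      _ = ∑ x ∈ P, (c / 2 * n) ^ T := by simp
      _ ≤ ∑ x ∈ P, d x ^ T := by
          refine sum_le_sum fun x hx => ?_
          simp only [hP, mem_filter, mem_univ, true_and] at hx
          gcongr
      _ ≤ _ := sum_le_sum_of_subset_of_nonneg (subset_univ _) fun x _ _ => by positivity
  have hup : (∑ y : τ → Y, (#{x : X | ∀ j, R (y j) x} : ℝ))
      ≤ #{y : τ → Y | ¬ Function.Injective y} * m + n ^ T * (c' * m) := by
    calc _ ≤ ∑ y : τ → Y, ((if ¬ Function.Injective y then m else 0) + c' * m) := by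
          refine sum_le_sum fun y _ => ?_
          split_ifs with h
          · have := hcon y h; linarith
          · have : (#{x : X | ∀ j, R (y j) x} : ℝ) ≤ m := by
              rw [hm]; exact_mod_cast card_le_univ _
            have : 0 ≤ c' * m := by positivity
            linarith
      _ = _ := by
          rw [sum_add_distrib, ← sum_filter]
          simp [hn, hT]
  have hnon : (#{y : τ → Y | ¬ Function.Injective y} : ℝ) ≤ c' * n ^ T := by
    have h := card_noninj (τ := τ) (Y := Y)
    have h' : (#{y : τ → Y | ¬ Function.Injective y} : ℝ) * n ≤ T ^ 2 * n ^ T := by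
      rw [hn, hT]; exact_mod_cast h
    have hNn : (T : ℝ) ^ 2 ≤ c' * n := by
      have : (N : ℝ) ≤ n := by rw [hn]; exact_mod_cast (by omega : N ≤ Fintype.card Y)
      rw [div_le_iff₀ hc'0] at hN
      nlinarith
    have : (#{y : τ → Y | ¬ Function.Injective y} : ℝ) * n ≤ c' * n ^ T * n := by
      refine h'.trans ?_
      have : 0 < n ^ T := by positivity
      nlinarith
    exact le_of_mul_le_mul_right this hn0
  have e1 : c / 2 * m * (c / 2 * n) ^ T = 3 * c' * (n ^ T * m) := by
    rw [hc', mul_pow, pow_succ]; ring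
  have hpos : 0 < c' * (n ^ T * m) := by positivity
  rw [hdc] at hup
  have := mul_le_mul_of_nonneg_right hnon hm0.le
  nlinarith

open Classical in
lemma erdos (τ : Type) [Fintype τ] (r : ℕ) : ∀ (c : ℝ) (hc : 0 < c),
    ∃ c' : ℝ, 0 < c' ∧ ∃ N : ℕ, ∀ (Y X : Type) [Fintype Y] [Fintype X], N ≤ Fintype.card Y →
      0 < Fintype.card X → ∀ E : (Fin r → Y) → X → Prop,
      c * (Fintype.card Y ^ r * Fintype.card X) ≤ (#{p : (Fin r → Y) × X | E p.1 p.2} : ℝ) →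
      ∃ g : Fin r → τ → Y, (∀ i, Function.Injective (g i)) ∧
        c' * Fintype.card X ≤ (#{x : X | ∀ s : Fin r → τ, E (fun i => g i (s i)) x} : ℝ) := by
  induction r with
  | zero =>
    intro c hc
    refine ⟨c, hc, 0, ?_⟩
    intro Y X _ _ _ _ E h
    refine ⟨fun i => i.elim0, fun i => i.elim0, ?_⟩
    simp only [pow_zero, one_mul] at h
    refine h.trans ?_
    norm_cast
    refine card_le_card_of_injOn (fun p => p.2) ?_ ?_
    · rintro ⟨f, x⟩ hf
      simp only [coe_filter, mem_univ, true_and, Set.mem_ofPred_eq] at hf ⊢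
      intro s
      convert hf
    · rintro ⟨f, x⟩ _ ⟨f', x'⟩ _ h
      exact Prod.ext (Subsingleton.elim _ _) h
  | succ r ih =>
    intro c hc
    obtain ⟨c1, hc1, N1, h1⟩ := ih c hc
    obtain ⟨c2, hc2, N2, h2⟩ := kst τ c1 hc1
    refine ⟨c2, hc2, N1 + N2 + 1, ?_⟩
    intro Y X _ _ hY hX E hE
    have hY0 : 0 < Fintype.card Y := by omega
    obtain ⟨g, hg, hgc⟩ := h1 Y (Y × X) (by omega) (by rw [Fintype.card_prod]; positivity)
      (fun f p => E (Fin.cons p.1 f) p.2) (by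
        rw [Fintype.card_prod]
        push_cast
        rw [pow_succ, mul_assoc] at hE
        refine hE.trans ?_
        norm_cast
        refine card_le_card_of_injOn (fun p => (Fin.tail p.1, p.1 0, p.2)) ?_ ?_
        · rintro ⟨f, x⟩ hf
          simpa using hf
        · rintro ⟨f, x⟩ _ ⟨f', x'⟩ _ h
          simp only [Prod.mk.injEq] at h
          refine Prod.ext ?_ h.2.2
          show f = f'
          rw [← Fin.cons_self_tail f, ← Fin.cons_self_tail f', h.1, h.2.1])
    obtain ⟨y, hy, hyc⟩ := h2 Y X (by omega) hX
      (fun y x => ∀ s : Fin r → τ, E (Fin.cons y fun i => g i (s i)) x) (by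
        rw [Fintype.card_prod] at hgc
        push_cast at hgc
        convert hgc)
    refine ⟨Fin.cons y g, ?_, hyc.trans ?_⟩
    · intro i
      refine Fin.cases ?_ (fun i => ?_) i
      · simpa using hy
      · simpa using hg i
    · norm_cast
      refine card_le_card fun x hx => ?_
      simp only [mem_filter, mem_univ, true_and] at hx ⊢
      intro s
      convert hx (s 0) (Fin.tail s) using 1
      funext i
      refine Fin.cases ?_ (fun i => ?_) i <;> simp [Fin.tail]

/-- A family of pairwise vertex-disjoint copies of `F_{k,ℓ}` in `H`. -/
def IsPack (k ℓ n : ℕ) (H : Finset (Finset (Fin n))) (ι : Type)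
    (φ : ι → FVert k ℓ → Fin n) : Prop :=
  (∀ p, Function.Injective (φ p)) ∧
  (∀ p, ∀ e ∈ FEdges k ℓ, e.image (φ p) ∈ H) ∧
  (∀ p p', p ≠ p' → ∀ x y, φ p x ≠ φ p' y)

lemma le_aParam (k ℓ : ℕ) (h : ℓ + 1 ≤ k) : k ≤ aParam k ℓ := by
  unfold aParam ceilQuot
  have hd : 0 < k - ℓ := by omega
  have h1 := Nat.div_add_mod (k + (k - ℓ) - 1) (k - ℓ)
  have h2 := Nat.mod_lt (k + (k - ℓ) - 1) hd
  rw [mul_comm] at h1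
  omega

lemma card_FVert (k ℓ : ℕ) (h : 1 ≤ aParam k ℓ) :
    Fintype.card (FVert k ℓ) = aParam k ℓ * (k - 1) := by
  obtain ⟨a, ha⟩ : ∃ a, aParam k ℓ = a + 1 := ⟨aParam k ℓ - 1, by omega⟩
  simp [FVert, ha]
  ring

lemma edges_of {k ℓ n : ℕ} {H : Finset (Finset (Fin n))} {f : FVert k ℓ → Fin n}
    (h : ∀ i b, insert (f (Sum.inr b)) (univ.image fun c => f (Sum.inl (i, c))) ∈ H) :
    ∀ e ∈ FEdges k ℓ, e.image f ∈ H := by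
  intro e he
  simp only [FEdges, mem_image, mem_univ, true_and] at he
  obtain ⟨⟨i, b⟩, rfl⟩ := he
  convert h i b using 1
  ext v
  simp only [mem_image, mem_union, mem_filter, mem_univ, true_and, mem_singleton, mem_insert]
  constructor
  · rintro ⟨x, ⟨⟨i', c⟩, rfl, rfl⟩ | rfl, rfl⟩
    · exact Or.inr ⟨c, rfl⟩
    · exact Or.inl rfl
  · rintro (rfl | ⟨c, rfl⟩)
    · exact ⟨_, Or.inr rfl, rfl⟩
    · exact ⟨_, Or.inl ⟨(i, c), rfl, rfl⟩, rfl⟩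

lemma build_pack {k ℓ n : ℕ} {H : Finset (Finset (Fin n))} {J : Type}
    (g : Fin (k - 1) → J × Fin (aParam k ℓ - 1) → Fin n)
    (w : J → Fin (k - 1) → Fin n)
    (hg : ∀ i i' x x', g i x = g i' x' → i = i' ∧ x = x')
    (hw : ∀ j j' b b', w j b = w j' b' → j = j' ∧ b = b')
    (hgw : ∀ i x j b, g i x ≠ w j b)
    (hE : ∀ (s : Fin (k - 1) → J × Fin (aParam k ℓ - 1)) j b,
      insert (w j b) (univ.image fun c => g c (s c)) ∈ H) :
    IsPack k ℓ n H J (fun j => Sum.elim (fun p => g p.2 (j, p.1)) (w j)) := by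
  refine ⟨?_, ?_, ?_⟩
  · rintro j (⟨i, c⟩ | b) (⟨i', c'⟩ | b') h
    · simp only [Sum.elim_inl] at h
      obtain ⟨h1, h2⟩ := hg _ _ _ _ h
      simp_all
    · exact absurd h (hgw _ _ _ _)
    · exact absurd h.symm (hgw _ _ _ _)
    · simp only [Sum.elim_inr] at h
      rw [(hw _ _ _ _ h).2]
  · intro j
    exact edges_of fun i b => hE (fun _ => (j, i)) j b
  · rintro j j' hj (⟨i, c⟩ | b) (⟨i', c'⟩ | b') h
    · simp only [Sum.elim_inl] at h
      obtain ⟨h1, h2⟩ := hg _ _ _ _ h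
      simp_all
    · exact absurd h (hgw _ _ _ _)
    · exact absurd h.symm (hgw _ _ _ _)
    · exact hj (hw _ _ _ _ h).1

lemma pack_sum {k ℓ n : ℕ} {H : Finset (Finset (Fin n))} {I J : Type}
    {φ : I → FVert k ℓ → Fin n} {ψ : J → FVert k ℓ → Fin n}
    (hφ : IsPack k ℓ n H I φ) (hψ : IsPack k ℓ n H J ψ)
    (h : ∀ i j x y, φ i x ≠ ψ j y) : IsPack k ℓ n H (I ⊕ J) (Sum.elim φ ψ) := by
  refine ⟨?_, ?_, ?_⟩
  · rintro (i | j)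
    · exact hφ.1 i
    · exact hψ.1 j
  · rintro (i | j)
    · exact hφ.2.1 i
    · exact hψ.2.1 j
  · rintro (i | j) (i' | j') hne x y
    · exact hφ.2.2 i i' (fun h => hne (by rw [h])) x y
    · exact h i j' x y
    · exact (h i' j y x).symm
    · exact hψ.2.2 j j' (fun h => hne (by rw [h])) x y

lemma pack_comp {k ℓ n : ℕ} {H : Finset (Finset (Fin n))} {I J : Type}
    {φ : I → FVert k ℓ → Fin n} (hφ : IsPack k ℓ n H I φ) (f : J → I)
    (hf : Function.Injective f) : IsPack k ℓ n H J (fun j => φ (f j)) :=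
  ⟨fun j => hφ.1 _, fun j => hφ.2.1 _, fun j j' h => hφ.2.2 _ _ (fun e => h (hf e))⟩

lemma pack_card {k ℓ n q : ℕ} {H : Finset (Finset (Fin n))}
    {φ : Fin q → FVert k ℓ → Fin n} (hφ : IsPack k ℓ n H (Fin q) φ) :
    q * Fintype.card (FVert k ℓ) +
      #(univ \ univ.biUnion (fun p => univ.image (φ p))) = n := by
  have h1 : #(univ.biUnion (fun p => univ.image (φ p))) = q * Fintype.card (FVert k ℓ) := by
    rw [card_biUnion]
    · simp only [card_image_of_injective _ (hφ.1 _)]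
      rw [sum_const, card_univ, card_univ, Fintype.card_fin, smul_eq_mul]
    · intro p _ p' _ hne
      rw [Function.onFun, disjoint_left]
      intro v hv hv'
      simp only [mem_image, mem_univ, true_and] at hv hv'
      obtain ⟨x, rfl⟩ := hv
      obtain ⟨y, hy⟩ := hv'
      exact hφ.2.2 p p' hne x y hy.symm
  have h2 := card_sdiff_add_card_eq_card (subset_univ (univ.biUnion (fun p => univ.image (φ p))))
  rw [h1, card_univ, Fintype.card_fin] at h2
  omega

lemma exists_max_pack (k ℓ n : ℕ) (H : Finset (Finset (Fin n)))
    (hM : 0 < Fintype.card (FVert k ℓ)) :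
    ∃ (q : ℕ) (φ : Fin q → FVert k ℓ → Fin n), IsPack k ℓ n H (Fin q) φ ∧
      ∀ (I : Type) [Fintype I] (ψ : I → FVert k ℓ → Fin n), IsPack k ℓ n H I ψ →
        Fintype.card I ≤ q := by
  classical
  let P : ℕ → Prop := fun q => ∃ φ : Fin q → FVert k ℓ → Fin n, IsPack k ℓ n H (Fin q) φ
  have hb : ∀ q, P q → q ≤ n := by
    rintro q ⟨φ, hφ⟩
    have := pack_card hφ
    nlinarith
  have h0 : P 0 := ⟨fun i => i.elim0, fun i => i.elim0, fun i => i.elim0, fun i => i.elim0⟩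
  obtain ⟨φ, hφ⟩ := Nat.findGreatest_spec (P := P) (Nat.zero_le n) h0
  refine ⟨_, φ, hφ, fun I _ ψ hψ => ?_⟩
  have hI : P (Fintype.card I) :=
    ⟨_, pack_comp hψ (Fintype.equivFin I).symm (Fintype.equivFin I).symm.injective⟩
  exact Nat.le_findGreatest (hb _ hI) hI

/-- Neighbourhood of a set. -/
def nbr (n : ℕ) (H : Finset (Finset (Fin n))) (S : Finset (Fin n)) : Finset (Fin n) :=
  univ.filter fun v => v ∉ S ∧ insert v S ∈ H

lemma degree_le_nbr {n k : ℕ} {H : Finset (Finset (Fin n))} (hH : IsKGraph n k H)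
    {S : Finset (Fin n)} (hk : 1 ≤ k) (hS : #S = k - 1) : degree n H S ≤ #(nbr n H S) := by
  refine le_trans (card_le_card (?_ : _ ⊆ (nbr n H S).image fun v => insert v S)) card_image_le
  intro e he
  simp only [mem_filter] at he
  have hc := hH e he.1
  have : #(e \ S) = 1 := by
    rw [card_sdiff_of_subset he.2]; omega
  obtain ⟨v, hv⟩ := card_eq_one.1 this
  have hve : v ∈ e \ S := by simp [hv]
  have he' : insert v S = e := by
    rw [insert_eq, ← hv, sdiff_union_of_subset he.2]
  simp only [mem_image, nbr, mem_filter, mem_univ, true_and]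
  exact ⟨v, ⟨(mem_sdiff.1 hve).2, he' ▸ he.1⟩, he'⟩

lemma nbr_count {k ℓ n q : ℕ}
    (φ : Fin q → FVert k ℓ → Fin n) (N : Finset (Fin n)) :
    #N ≤ #(N ∩ (univ \ univ.biUnion (fun p => univ.image (φ p))))
      + ((k - 1) * q + Fintype.card (FVert k ℓ) * #{i : Fin q | k ≤ #{x | φ i x ∈ N}}) := by
  set L := univ \ univ.biUnion (fun p => univ.image (φ p)) with hL
  have h1 : N ⊆ (N ∩ L) ∪ univ.biUnion (fun i => (univ.filter fun x => φ i x ∈ N).image (φ i)) := by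
    intro v hv
    by_cases hvL : v ∈ L
    · exact mem_union_left _ (mem_inter.2 ⟨hv, hvL⟩)
    · simp only [hL, mem_sdiff, mem_univ, true_and, not_not, mem_biUnion, mem_image] at hvL
      obtain ⟨i, x, rfl⟩ := hvL
      refine mem_union_right _ ?_
      simp only [mem_biUnion, mem_image, mem_filter, mem_univ, true_and]
      exact ⟨i, x, hv, rfl⟩
  refine (card_le_card h1).trans ((card_union_le _ _).trans (Nat.add_le_add_left ?_ _))
  refine card_biUnion_le.trans ?_
  calc _ ≤ ∑ i : Fin q, ((k - 1) +
        if k ≤ #{x | φ i x ∈ N} then Fintype.card (FVert k ℓ) else 0) := by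
        refine sum_le_sum fun i _ => card_image_le.trans ?_
        split_ifs with h
        · exact (card_le_univ _).trans (Nat.le_add_left _ _)
        · omega
    _ = _ := by
        rw [sum_add_distrib, ← sum_filter]
        simp [mul_comm]

lemma good_count {n r : ℕ} (L : Finset (Fin n)) (Bad : Finset (Finset (Fin n)))
    (hB : ∀ A ∈ Bad, #A = r) (G : Finset (Fin r → Fin n))
    (hG : ∀ s : Fin r → Fin n, Function.Injective s → (∀ c, s c ∈ L) → univ.image s ∉ Bad → s ∈ G) :
    #L ^ r ≤ #G + #{y : Fin r → Fin n | ¬ Function.Injective y} + #Bad * r ^ r := by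
  classical
  have h1 : Fintype.piFinset (fun _ : Fin r => L) ⊆
      (G ∪ univ.filter fun y : Fin r → Fin n => ¬ Function.Injective y) ∪
        Bad.biUnion fun A => Fintype.piFinset (fun _ : Fin r => A) := by
    intro s hs
    rw [Fintype.mem_piFinset] at hs
    simp only [mem_union, mem_filter, mem_univ, true_and, mem_biUnion, Fintype.mem_piFinset]
    by_cases hi : Function.Injective s
    · by_cases hb : univ.image s ∈ Bad
      · exact Or.inr ⟨_, hb, fun c => mem_image_of_mem _ (mem_univ _)⟩
      · exact Or.inl (Or.inl (hG s hi hs hb))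
    · exact Or.inl (Or.inr hi)
  have h2 := card_le_card h1
  rw [Fintype.card_piFinset_const] at h2
  refine h2.trans ((card_union_le _ _).trans (Nat.add_le_add (card_union_le _ _) ?_))
  refine card_biUnion_le.trans ?_
  rw [← smul_eq_mul]
  refine sum_le_card_nsmul _ _ _ fun A hA => ?_
  rw [Fintype.card_piFinset_const, hB A hA]

lemma joint_inj {r : ℕ} {τ Y : Type} (g : Fin r → τ → Y)
    (hg : ∀ i, Function.Injective (g i))
    (h : ∀ s : Fin r → τ, Function.Injective fun i => g i (s i)) :
    ∀ i i' x x', g i x = g i' x' → i = i' ∧ x = x' := by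
  intro i i' x x' e
  by_cases hi : i = i'
  · subst hi
    exact ⟨rfl, hg i e⟩
  · exfalso
    apply hi
    refine h (Function.update (fun _ => x') i x) ?_
    simp [Function.update_of_ne (Ne.symm hi), e]

lemma case_one {k ℓ n q : ℕ} {H : Finset (Finset (Fin n))} (ha : 2 ≤ aParam k ℓ)
    {φ : Fin q → FVert k ℓ → Fin n} (hφ : IsPack k ℓ n H (Fin q) φ)
    (G : Finset (Fin (k - 1) → Fin n)) (hGi : ∀ s ∈ G, Function.Injective s)
    (hGL : ∀ s ∈ G, ∀ c, s c ∈ univ \ univ.biUnion (fun p => univ.image (φ p)))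
    (g : Fin (k - 1) → Unit × Fin (aParam k ℓ - 1) → Fin n) (hg : ∀ i, Function.Injective (g i))
    (Z : Finset (Fin n)) (hZ : k - 1 ≤ #Z)
    (hZE : ∀ v ∈ Z, ∀ s : Fin (k - 1) → Unit × Fin (aParam k ℓ - 1),
      (fun i => g i (s i)) ∈ G ∧ v ∈ nbr n H (univ.image fun i => g i (s i)) ∩
        (univ \ univ.biUnion (fun p => univ.image (φ p)))) (hk : 2 ≤ k) :
    ∃ ψ : Fin q ⊕ Unit → FVert k ℓ → Fin n, IsPack k ℓ n H _ ψ := by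
  obtain ⟨w⟩ : Nonempty (Fin (k - 1) ↪ Z) :=
    Function.Embedding.nonempty_of_card_le (by simpa using hZ)
  have v0 := w ⟨0, by omega⟩
  have hgj := joint_inj g hg (fun s => hGi _ (hZE v0 v0.2 s).1)
  have hgL : ∀ i x, g i x ∈ univ \ univ.biUnion (fun p => univ.image (φ p)) := fun i x =>
    hGL _ (hZE v0 v0.2 (fun _ => x)).1 i
  have x0 : Unit × Fin (aParam k ℓ - 1) := ((), ⟨0, by omega⟩)
  have hwL : ∀ b, (w b : Fin n) ∈ univ \ univ.biUnion (fun p => univ.image (φ p)) := fun b =>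
    (mem_inter.1 (hZE (w b) (w b).2 (fun _ => x0)).2).2
  have hpack := build_pack (ℓ := ℓ) (H := H) g (fun _ b => (w b : Fin n)) hgj
    (fun j j' b b' h => ⟨rfl, w.injective (Subtype.ext h)⟩)
    (fun i x j b h => by
      have := (mem_inter.1 (hZE (w b) (w b).2 (fun _ => x)).2).1
      simp only [nbr, mem_filter, mem_univ, true_and] at this
      exact this.1 (mem_image.2 ⟨i, mem_univ _, h⟩))
    (fun s j b => by
      have := (mem_inter.1 (hZE (w b) (w b).2 s).2).1
      simp only [nbr, mem_filter, mem_univ, true_and] at this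
      exact this.2)
  refine ⟨_, pack_sum hφ hpack ?_⟩
  have hout : ∀ v ∈ univ \ univ.biUnion (fun p => univ.image (φ p)), ∀ i x, φ i x ≠ v := by
    rintro v hv i x rfl
    simp only [mem_sdiff, mem_biUnion, mem_image, mem_univ, true_and] at hv
    exact hv ⟨i, x, rfl⟩
  rintro i j x (⟨i', c⟩ | b)
  · exact hout _ (hgL _ _) _ _
  · exact hout _ (hwL _) _ _

lemma case_two {k ℓ n q : ℕ} {H : Finset (Finset (Fin n))}
    {φ : Fin q → FVert k ℓ → Fin n} (hφ : IsPack k ℓ n H (Fin q) φ)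
    (G : Finset (Fin (k - 1) → Fin n)) (hGi : ∀ s ∈ G, Function.Injective s)
    (hGL : ∀ s ∈ G, ∀ c, s c ∈ univ \ univ.biUnion (fun p => univ.image (φ p)))
    (g : Fin (k - 1) → Fin k × Fin (aParam k ℓ - 1) → Fin n) (hg : ∀ i, Function.Injective (g i))
    (I : Finset (Fin q)) (hI : k - 1 ≤ #I) (w : Fin q → Fin k → FVert k ℓ)
    (hw : ∀ i ∈ I, Function.Injective (w i))
    (hIE : ∀ i ∈ I, ∀ s : Fin (k - 1) → Fin k × Fin (aParam k ℓ - 1),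
      (fun i => g i (s i)) ∈ G ∧ ∀ j, φ i (w i j) ∈ nbr n H (univ.image fun i => g i (s i)))
    (hk : 2 ≤ k) :
    ∃ (J : Type) (_ : Fintype J) (ψ : J → FVert k ℓ → Fin n),
      IsPack k ℓ n H J ψ ∧ q < Fintype.card J := by
  classical
  obtain ⟨u⟩ : Nonempty (Fin (k - 1) ↪ I) :=
    Function.Embedding.nonempty_of_card_le (by simpa using hI)
  have i0 := u ⟨0, by omega⟩
  have hgj := joint_inj g hg (fun s => hGi _ (hIE i0 i0.2 s).1)
  have hgL : ∀ i x, g i x ∈ univ \ univ.biUnion (fun p => univ.image (φ p)) := fun i x =>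
    hGL _ (hIE i0 i0.2 (fun _ => x)).1 i
  have hout : ∀ v ∈ univ \ univ.biUnion (fun p => univ.image (φ p)), ∀ i x, φ i x ≠ v := by
    rintro v hv i x rfl
    simp only [mem_sdiff, mem_biUnion, mem_image, mem_univ, true_and] at hv
    exact hv ⟨i, x, rfl⟩
  have hpack := build_pack (ℓ := ℓ) (H := H) g (fun j b => φ (u b) (w (u b) j)) hgj
    (fun j j' b b' h => by
      have hb : (u b : Fin q) = u b' := by
        by_contra hne
        exact hφ.2.2 _ _ hne _ _ h
      have hb' : b = b' := u.injective (Subtype.ext hb)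
      subst hb'
      exact ⟨hw _ (u b).2 (hφ.1 _ h), rfl⟩)
    (fun i x j b h => hout _ (hgL i x) _ _ h.symm)
    (fun s j b => by
      have := (hIE (u b) (u b).2 s).2 j
      simp only [nbr, mem_filter, mem_univ, true_and] at this
      exact this.2)
  let I' : Finset (Fin q) := univ.image fun b => (u b : Fin q)
  have hI' : #I' = k - 1 := by
    rw [card_image_of_injective _ (fun b b' h => u.injective (Subtype.ext h))]; simp
  refine ⟨{i : Fin q // i ∉ I'} ⊕ Fin k, inferInstance, _,
    pack_sum (pack_comp hφ Subtype.val Subtype.val_injective) hpack ?_, ?_⟩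
  · rintro ⟨i, hi⟩ j x (⟨i', c⟩ | b)
    · exact hout _ (hgL _ _) _ _
    · refine hφ.2.2 _ _ (fun h => hi ?_) _ _
      exact mem_image.2 ⟨b, mem_univ _, h.symm⟩
  · have h1 : Fintype.card {i : Fin q // i ∉ I'} = q - (k - 1) := by
      rw [Fintype.card_subtype_compl]; simp [hI']
    have h2 : k - 1 ≤ q := by
      rw [← hI']; simpa using card_le_univ I'
    rw [Fintype.card_sum, h1, Fintype.card_fin]
    omega

set_option maxHeartbeats 2000000

/-- Lemma 14: if almost all `(k-1)`-sets of a `k`-graph `H` have degree at least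
`n/a`, then `H` has an `F_{k,ℓ}`-packing covering all but at most `εn` vertices. -/
theorem F_packing_lemma
    (k ℓ : ℕ) (hk : 3 ≤ k) (hl1 : 1 ≤ ℓ) (hl2 : ℓ ≤ k - 1)
    (ε : ℝ) (hε : 0 < ε) :
    ∃ θ : ℝ, 0 < θ ∧ θ < ε ∧ ∃ n₀ : ℕ, ∀ n ≥ n₀,
      ∀ H : Finset (Finset (Fin n)), IsKGraph n k H →
        (((Finset.univ.powersetCard (k - 1)).filter
            (fun A => (degree n H A : ℝ) < (n : ℝ) / (aParam k ℓ : ℝ))).card : ℝ)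
          ≤ θ * (n : ℝ) ^ (k - 1) →
        ∃ (q : ℕ) (φ : Fin q → FVert k ℓ → Fin n),
          (∀ p, Function.Injective (φ p)) ∧
          (∀ p, ∀ e ∈ FEdges k ℓ, e.image (φ p) ∈ H) ∧
          (∀ p p', p ≠ p' → ∀ x y, φ p x ≠ φ p' y) ∧
          (((Finset.univ \
              Finset.univ.biUnion (fun p => Finset.univ.image (φ p))).card : ℝ)
            ≤ ε * n) := by
  classical
  have hak : k ≤ aParam k ℓ := le_aParam k ℓ (by omega)
  have hcardF := card_FVert k ℓ (by omega)
  set a : ℕ := aParam k ℓ with ha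
  set M : ℕ := Fintype.card (FVert k ℓ) with hM
  have hM0 : 0 < M := by rw [hcardF]; exact Nat.mul_pos (by omega) (by omega)
  have ha0 : (0 : ℝ) < a := by exact_mod_cast (by omega : 0 < a)
  have hMR : (0 : ℝ) < M := by exact_mod_cast hM0
  set r : ℕ := k - 1 with hr
  have hr2 : 2 ≤ r := by omega
  have hrR : (0 : ℝ) < r := by exact_mod_cast (by omega : 0 < r)
  -- constants
  set c : ℝ := ε ^ (r + 1) / (4 * a) with hc
  have hc0 : 0 < c := by positivity
  set C : ℝ := (M : ℝ) ^ k with hC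
  have hC0 : 0 < C := by positivity
  obtain ⟨c1, hc1, N1, hE1⟩ := erdos (Unit × Fin (a - 1)) r c hc0
  obtain ⟨c2, hc2, N2, hE2⟩ := erdos (Fin k × Fin (a - 1)) r (c / M / C) (by positivity)
  obtain ⟨N3, hN3⟩ := exists_nat_ge ((r : ℝ) / c1)
  obtain ⟨N4, hN4⟩ := exists_nat_ge ((r : ℝ) / (c2 * (c / M)))
  obtain ⟨N5, hN5⟩ := exists_nat_ge ((r : ℝ) ^ 2 / (ε ^ r / 4))
  refine ⟨min (ε / 2) (ε ^ r / 4 / (r : ℝ) ^ r), by positivity,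
    lt_of_le_of_lt (min_le_left _ _) (by linarith), N1 + N2 + N3 + N4 + N5 + 1, ?_⟩
  intro n hn H hH hbad
  obtain ⟨q, φ, hφ, hmax⟩ := exists_max_pack k ℓ n H hM0
  refine ⟨q, φ, hφ.1, hφ.2.1, hφ.2.2, ?_⟩
  by_contra hcon
  push Not at hcon
  have hcount := pack_card hφ
  have hnbr := fun N => nbr_count φ N
  have hcase1 := fun ha2 G hGi hGL g hg Z hZ hZE => case_one (H := H) ha2 hφ G hGi hGL g hg Z hZ hZE
  have hcase2 := fun G hGi hGL g hg Z hZ w hw hZE =>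
    case_two (H := H) hφ G hGi hGL g hg Z hZ w hw hZE
  set L : Finset (Fin n) := univ \ univ.biUnion (fun p => univ.image (φ p)) with hL
  rw [← hM] at hcount
  have hnR : (0 : ℝ) < n := by exact_mod_cast (by omega : 0 < n)
  have hqn : q ≤ n := by nlinarith
  -- the good tuples
  set Bad := (univ.powersetCard r).filter
    (fun A : Finset (Fin n) => (degree n H A : ℝ) < (n : ℝ) / (a : ℝ)) with hBad
  set G : Finset (Fin r → Fin n) := univ.filter fun s =>
    Function.Injective s ∧ (∀ c, s c ∈ L) ∧ univ.image s ∉ Bad with hG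
  have hGmem : ∀ s, s ∈ G ↔ Function.Injective s ∧ (∀ c, s c ∈ L) ∧ univ.image s ∉ Bad := by
    intro s; simp [hG]
  have hGc : ε ^ r / 2 * (n : ℝ) ^ r ≤ #G := by
    have h1 := good_count L Bad (fun A hA => by
      simp only [hBad, mem_filter, mem_powersetCard] at hA
      exact hA.1.2) G (fun s h1 h2 h3 => (hGmem s).2 ⟨h1, h2, h3⟩)
    have h1R : (#L : ℝ) ^ r ≤ #G + #{y : Fin r → Fin n | ¬ Function.Injective y}
        + #Bad * (r : ℝ) ^ r := by exact_mod_cast h1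
    have h2 : (#Bad : ℝ) * (r : ℝ) ^ r ≤ ε ^ r / 4 * (n : ℝ) ^ r := by
      have h3 : (#Bad : ℝ) ≤ ε ^ r / 4 / (r : ℝ) ^ r * (n : ℝ) ^ r :=
        hbad.trans (mul_le_mul_of_nonneg_right (min_le_right _ _) (by positivity))
      have h4 := mul_le_mul_of_nonneg_right h3 (by positivity : (0 : ℝ) ≤ (r : ℝ) ^ r)
      refine h4.trans (le_of_eq ?_)
      field_simp
    have h5 : (#{y : Fin r → Fin n | ¬ Function.Injective y} : ℝ) ≤ ε ^ r / 4 * (n : ℝ) ^ r := by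
      have h := card_noninj (τ := Fin r) (Y := Fin n)
      simp only [Fintype.card_fin] at h
      have h' : (#{y : Fin r → Fin n | ¬ Function.Injective y} : ℝ) * n ≤ (r : ℝ) ^ 2 * (n : ℝ) ^ r := by
        exact_mod_cast h
      have h6 : (r : ℝ) ^ 2 ≤ ε ^ r / 4 * n := by
        rw [div_le_iff₀ (by positivity)] at hN5
        have : (N5 : ℝ) ≤ n := by exact_mod_cast (by omega : N5 ≤ n)
        have h7 : 0 < ε ^ r / 4 := by positivity
        nlinarith
      have h8 : (#{y : Fin r → Fin n | ¬ Function.Injective y} : ℝ) * n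
          ≤ ε ^ r / 4 * (n : ℝ) ^ r * n := by
        refine h'.trans ?_
        have := mul_le_mul_of_nonneg_right h6 (by positivity : (0 : ℝ) ≤ (n : ℝ) ^ r)
        linarith
      exact le_of_mul_le_mul_right h8 hnR
    have h9 : ε ^ r * (n : ℝ) ^ r ≤ (#L : ℝ) ^ r := by
      rw [← mul_pow]
      exact pow_le_pow_left₀ (by positivity) hcon.le _
    linarith
  -- abbreviations
  let f1 : (Fin r → Fin n) → ℕ := fun s => #(nbr n H (univ.image s) ∩ L)
  let f2 : (Fin r → Fin n) → ℕ := fun s =>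
    #{i : Fin q | k ≤ #{x | φ i x ∈ nbr n H (univ.image s)}}
  have hpt : ∀ s ∈ G, ε * n / a ≤ (f1 s : ℝ) + M * f2 s := by
    intro s hs
    obtain ⟨hsi, hsL, hsB⟩ := (hGmem s).1 hs
    have hcs : #(univ.image s) = r := by rw [card_image_of_injective _ hsi]; simp
    have hdeg : (n : ℝ) / a ≤ degree n H (univ.image s) := by
      by_contra hlt
      push Not at hlt
      apply hsB
      simp only [hBad, mem_filter, mem_powersetCard]
      exact ⟨⟨subset_univ _, hcs⟩, hlt⟩
    have h1 : degree n H (univ.image s) ≤ f1 s + (r * q + M * f2 s) :=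
      (degree_le_nbr hH (by omega) hcs).trans (hnbr _)
    have h1R : (degree n H (univ.image s) : ℝ) ≤ f1 s + (r * q + M * f2 s) := by
      exact_mod_cast h1
    have h2 : (n : ℝ) / a = r * q + #L / a := by
      have : (q : ℝ) * (a * r) + #L = n := by
        rw [hcardF] at hcount; exact_mod_cast hcount
      rw [← this]; field_simp
    have h3 : ε * n / a ≤ #L / a := by gcongr
    linarith
  have hsum : 2 * c * (n : ℝ) ^ (r + 1) ≤ (∑ s ∈ G, (f1 s : ℝ)) + M * ∑ s ∈ G, (f2 s : ℝ) := by
    have h1 : (#G : ℝ) * (ε * n / a) ≤ ∑ s ∈ G, ((f1 s : ℝ) + M * f2 s) := by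
      rw [← nsmul_eq_mul]
      exact card_nsmul_le_sum _ _ _ hpt
    rw [sum_add_distrib, ← mul_sum] at h1
    refine le_trans ?_ h1
    have h2 := mul_le_mul_of_nonneg_right hGc (by positivity : 0 ≤ ε * n / a)
    refine le_trans (le_of_eq ?_) h2
    rw [hc, pow_succ, pow_succ]
    field_simp
    ring
  by_cases hcs : c * (n : ℝ) ^ (r + 1) ≤ ∑ s ∈ G, (f1 s : ℝ)
  · -- many edges inside L
    obtain ⟨g, hg, hgc⟩ := hE1 (Fin n) (Fin n) (by simp; omega) (by simp; omega)
      (fun s v => s ∈ G ∧ v ∈ nbr n H (univ.image s) ∩ L) (by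
        simp only [Fintype.card_fin]
        rw [← pow_succ]
        refine hcs.trans ?_
        norm_cast
        rw [← card_sigma]
        refine card_le_card_of_injOn (fun p => (p.1, p.2)) ?_ ?_
        · rintro ⟨s, v⟩ h
          simp only [coe_sigma, Set.mem_sigma_iff, mem_coe] at h
          simp only [mem_coe, mem_filter, mem_univ, true_and]
          exact h
        · rintro ⟨s, v⟩ _ ⟨s', v'⟩ _ h
          simp only [Prod.mk.injEq] at h
          obtain ⟨rfl, rfl⟩ := h
          rfl)
    simp only [Fintype.card_fin] at hgc
    set Z := univ.filter fun x : Fin n => ∀ s : Fin r → Unit × Fin (a - 1),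
      (fun i => g i (s i)) ∈ G ∧ x ∈ nbr n H (univ.image fun i => g i (s i)) ∩ L with hZ
    replace hgc : c1 * n ≤ (#Z : ℝ) := by convert hgc
    have hZr : r ≤ #Z := by
      have h1 : (r : ℝ) ≤ c1 * n := by
        rw [div_le_iff₀ hc1] at hN3
        have : (N3 : ℝ) ≤ n := by exact_mod_cast (by omega : N3 ≤ n)
        nlinarith
      have h2 := h1.trans hgc
      exact_mod_cast h2
    obtain ⟨ψ, hψ⟩ := hcase1 (by omega) G (fun s hs => ((hGmem s).1 hs).1)
      (fun s hs => ((hGmem s).1 hs).2.1) g hg Z hZr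
      (fun v hv => by simpa only [hZ, mem_filter, mem_univ, true_and] using hv) (by omega)
    have := hmax _ ψ hψ
    simp at this
  · push Not at hcs
    have hcs2 : c / M * (n : ℝ) ^ (r + 1) ≤ ∑ s ∈ G, (f2 s : ℝ) := by
      rw [div_mul_eq_mul_div, div_le_iff₀ hMR]
      linarith
    have hq : c / M * n ≤ q := by
      have h1 : ∑ s ∈ G, (f2 s : ℝ) ≤ (n : ℝ) ^ r * q := by
        calc ∑ s ∈ G, (f2 s : ℝ) ≤ ∑ s ∈ G, (q : ℝ) := by
              refine sum_le_sum fun s _ => ?_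
              have : f2 s ≤ q := by simpa using card_le_univ (univ.filter fun i : Fin q => k ≤ #{x | φ i x ∈ nbr n H (univ.image s)})
              exact_mod_cast this
          _ = #G * q := by simp
          _ ≤ _ := by
              have : #G ≤ n ^ r := by simpa using card_le_univ G
              gcongr
              exact_mod_cast this
      have h2 : c / M * n * (n : ℝ) ^ r ≤ q * (n : ℝ) ^ r := by
        have := hcs2.trans h1
        rw [pow_succ] at this
        linarith
      exact le_of_mul_le_mul_right h2 (by positivity)
    have hq0 : 0 < q := by
      have : (0 : ℝ) < q := lt_of_lt_of_le (by positivity) hq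
      exact_mod_cast this
    have hwex : ∀ (s : Fin r → Fin n) (i : Fin q), k ≤ #{x | φ i x ∈ nbr n H (univ.image s)} →
        ∃ w : Fin k → FVert k ℓ, Function.Injective w ∧
          ∀ j, φ i (w j) ∈ nbr n H (univ.image s) := by
      intro s i h
      obtain ⟨w⟩ : Nonempty (Fin k ↪ (univ.filter fun x => φ i x ∈ nbr n H (univ.image s))) :=
        Function.Embedding.nonempty_of_card_le (by rw [Fintype.card_coe, Fintype.card_fin]; exact h)
      exact ⟨fun j => w j, fun j j' h => w.injective (Subtype.ext h),
        fun j => (mem_filter.1 (w j).2).2⟩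
    have : Nonempty (FVert k ℓ) := Fintype.card_pos_iff.1 hM0
    choose! w0 hw0 using hwex
    have hcX : (Fintype.card (Fin q × (Fin k → FVert k ℓ)) : ℝ) = q * C := by
      rw [Fintype.card_prod, Fintype.card_fun, Fintype.card_fin, Fintype.card_fin, hC, hM]
      push_cast
      rfl
    obtain ⟨g, hg, hgc⟩ := hE2 (Fin n) (Fin q × (Fin k → FVert k ℓ)) (by simp; omega)
      (by
        have : (0 : ℝ) < (Fintype.card (Fin q × (Fin k → FVert k ℓ)) : ℝ) := by
          rw [hcX]
          have : (0 : ℝ) < q := by exact_mod_cast hq0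
          positivity
        exact_mod_cast this)
      (fun s p => s ∈ G ∧ Function.Injective p.2 ∧
        ∀ j, φ p.1 (p.2 j) ∈ nbr n H (univ.image s)) (by
        rw [hcX, Fintype.card_fin]
        have h1 : c / M / C * ((n : ℝ) ^ r * (q * C)) ≤ c / M * (n : ℝ) ^ (r + 1) := by
          have e : c / M / C * ((n : ℝ) ^ r * (q * C)) = c / M * ((n : ℝ) ^ r * q) := by
            field_simp
          rw [e, pow_succ]
          have : (q : ℝ) ≤ n := by exact_mod_cast hqn
          gcongr
        refine h1.trans (hcs2.trans ?_)
        norm_cast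
        rw [← card_sigma]
        refine card_le_card_of_injOn (fun p => (p.1, p.2, w0 p.1 p.2)) ?_ ?_
        · rintro ⟨s, i⟩ h
          simp only [coe_sigma, Set.mem_sigma_iff, mem_coe, mem_filter, mem_univ, true_and] at h
          simp only [mem_coe, mem_filter, mem_univ, true_and]
          exact ⟨h.1, hw0 s i h.2⟩
        · rintro ⟨s, v⟩ _ ⟨s', v'⟩ _ h
          simp only [Prod.mk.injEq] at h
          obtain ⟨rfl, rfl, _⟩ := h
          rfl)
    rw [hcX] at hgc
    set Z := univ.filter fun x : Fin q × (Fin k → FVert k ℓ) =>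
      ∀ s : Fin r → Fin k × Fin (a - 1),
      (fun i => g i (s i)) ∈ G ∧ Function.Injective x.2 ∧
        ∀ j, φ x.1 (x.2 j) ∈ nbr n H (univ.image fun i => g i (s i)) with hZ
    replace hgc : c2 * (q * C) ≤ (#Z : ℝ) := by convert hgc
    have hZI : #Z ≤ #(Z.image Prod.fst) * M ^ k := by
      have hsub : Z ⊆ (Z.image Prod.fst) ×ˢ (univ : Finset (Fin k → FVert k ℓ)) := by
        intro x hx
        exact mem_product.2 ⟨mem_image_of_mem _ hx, mem_univ _⟩
      refine (card_le_card hsub).trans (le_of_eq ?_)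
      rw [card_product, card_univ, Fintype.card_fun, Fintype.card_fin]
    have hIr : r ≤ #(Z.image Prod.fst) := by
      have h1 : (r : ℝ) ≤ c2 * q := by
        rw [div_le_iff₀ (by positivity)] at hN4
        have h2 : (N4 : ℝ) ≤ n := by exact_mod_cast (by omega : N4 ≤ n)
        have h3 := mul_le_mul_of_nonneg_left hq hc2.le
        have h4 := mul_le_mul_of_nonneg_right h2 (by positivity : 0 ≤ c2 * (c / M))
        linarith
      have h2 : (#Z : ℝ) ≤ #(Z.image Prod.fst) * C := by
        rw [hC]; exact_mod_cast hZI
      have h3 : c2 * q * C ≤ #(Z.image Prod.fst) * C := by linarith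
      have h4 := h1.trans (le_of_mul_le_mul_right h3 hC0)
      exact_mod_cast h4
    have hsel : ∀ i : Fin q, i ∈ Z.image Prod.fst → ∃ w : Fin k → FVert k ℓ, (i, w) ∈ Z := by
      intro i hi
      obtain ⟨⟨i', w⟩, h, rfl⟩ := mem_image.1 hi
      exact ⟨w, h⟩
    choose! w hw using hsel
    have hw' : ∀ i ∈ Z.image Prod.fst, ∀ s : Fin r → Fin k × Fin (a - 1),
        (fun i => g i (s i)) ∈ G ∧ Function.Injective (w i) ∧
        ∀ j, φ i (w i j) ∈ nbr n H (univ.image fun i => g i (s i)) := by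
      intro i hi
      have := hw i hi
      simpa only [hZ, mem_filter, mem_univ, true_and] using this
    obtain ⟨J, _, ψ, hψ, hJ⟩ := hcase2 G (fun s hs => ((hGmem s).1 hs).1)
      (fun s hs => ((hGmem s).1 hs).2.1) g hg (Z.image Prod.fst) hIr w
      (fun i hi => (hw' i hi (fun _ => (⟨0, by omega⟩, ⟨0, by omega⟩))).2.1)
      (fun i hi s => ⟨(hw' i hi s).1, (hw' i hi s).2.2⟩) (by omega)
    exact absurd (hmax J ψ hψ) (by omega)
end

section
/- Suppose k ≥ 2, 1 ≤ s ≤ k−1, and α, μ > 0. For every δ > 0 there exists n₀ such that the following holds for all n ≥ n₀. Let H be a k-graph of order n with d_H(S) ≥ μ·C(n, k−s) for every set S of s vertices of H (so every s-set has at least μ·C(n, k−s) (k−s)-sets B disjoint from it with S ∪ B an edge), and let R be a subset of V(H) of size αn chosen uniformly at random among all such subsets. Then with probability at least 1 − δ, every set S of s vertices of H satisfies |N_H(S) ∩ C(R, k−s)| ≥ μ·C(αn, k−s) − n^{k−s−1/3}, where C(R, k−s) denotes the collection of (k−s)-element subsets of R. -/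
open Finset

lemma two_point (p q x y c : ℝ) (hp : 0 ≤ p) (hq : 0 ≤ q) (hpq : q + p = 1) 
    (hxy : |x - y| ≤ c) :
    q * Real.exp (x - (q * x + p * y)) + p * Real.exp (y - (q * x + p * y)) ≤
      Real.exp (c ^ 2 / 2) := by
  have hc : 0 ≤ c := (abs_nonneg _).trans hxy
  rcases hc.eq_or_lt with h0 | h0
  · subst h0
    have : x = y := by
      have := abs_nonpos_iff.1 hxy
      linarith
    subst this
    have e : x - (q * x + p * x) = 0 := by rw [← add_mul, hpq]; ring
    rw [e]; simp [hpq]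
  have key : ∀ u : ℝ, |u| ≤ c →
      Real.exp u ≤ Real.cosh c + u / c * Real.sinh c := by
    intro u hu
    have hu' := abs_le.1 hu
    have p1 : 0 ≤ (1 - u / c) / 2 := by
      have : u / c ≤ 1 := by rw [div_le_one h0]; exact hu'.2
      linarith
    have p2 : 0 ≤ (1 + u / c) / 2 := by
      have : -1 ≤ u / c := by rw [le_div_iff₀ h0]; linarith
      linarith
    have cv := convexOn_exp.2
    have h := cv (Set.mem_univ (-c)) (Set.mem_univ c) p1 p2 (by ring)
    simp only [smul_eq_mul] at h
    have e : (1 - u / c) / 2 * -c + (1 + u / c) / 2 * c = u := by field_simp; ring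
    rw [e] at h
    rw [Real.cosh_eq, Real.sinh_eq]
    linarith
  have hx := abs_le.1 hxy
  have hq' : q = 1 - p := by linarith
  subst hq'
  have e1 : x - ((1 - p) * x + p * y) = p * (x - y) := by ring
  have e2 : y - ((1 - p) * x + p * y) = -((1 - p) * (x - y)) := by ring
  rw [e1, e2]
  have b1 := key (p * (x - y)) (by
    rw [abs_mul, abs_of_nonneg hp]; nlinarith [abs_nonneg (x - y)])
  have b2 := key (-((1 - p) * (x - y))) (by
    rw [abs_neg, abs_mul, abs_of_nonneg hq]; nlinarith [abs_nonneg (x - y)])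
  calc _ ≤ (1 - p) * (Real.cosh c + (p * (x - y)) / c * Real.sinh c) +
        p * (Real.cosh c + (-((1 - p) * (x - y))) / c * Real.sinh c) :=
        add_le_add (mul_le_mul_of_nonneg_left b1 hq) (mul_le_mul_of_nonneg_left b2 hp)
    _ = Real.cosh c := by ring
    _ ≤ _ := Real.cosh_le_exp_half_sq c

variable {β : Type*} [DecidableEq β]

lemma sum_split (V : Finset β) (v : β) (hv : v ∉ V) (m : ℕ) (g : Finset β → ℝ) :
    ∑ R ∈ (insert v V).powersetCard (m + 1), g R =
      ∑ R ∈ V.powersetCard (m + 1), g R + ∑ R ∈ V.powersetCard m, g (insert v R) := by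
  rw [powersetCard_succ_insert hv, sum_union, sum_image]
  · intro a ha b hb hab
    have h1 : v ∉ a := fun h => hv ((mem_powersetCard.1 ha).1 h)
    have h2 : v ∉ b := fun h => hv ((mem_powersetCard.1 hb).1 h)
    rw [← erase_insert h1, ← erase_insert h2, hab]
  · rw [disjoint_left]
    intro a ha hb
    obtain ⟨b, -, rfl⟩ := mem_image.1 hb
    exact hv ((mem_powersetCard.1 ha).1 (mem_insert_self _ _))

lemma double_count (V : Finset β) (m : ℕ) (f : Finset β → ℝ) :
    ((m : ℝ) + 1) * ∑ R ∈ V.powersetCard (m + 1), f R =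
      ∑ T ∈ V.powersetCard m, ∑ x ∈ V \ T, f (insert x T) := by
  have : ((m : ℝ) + 1) * ∑ R ∈ V.powersetCard (m + 1), f R =
      ∑ R ∈ V.powersetCard (m + 1), ∑ x ∈ R, f R := by
    rw [mul_sum]
    refine sum_congr rfl fun R hR => ?_
    rw [sum_const, (mem_powersetCard.1 hR).2]; simp
  rw [this, sum_sigma', sum_sigma']
  refine sum_bij' (fun p _ => ⟨p.1.erase p.2, p.2⟩) (fun p _ => ⟨insert p.2 p.1, p.2⟩)
    ?_ ?_ ?_ ?_ ?_
  · rintro ⟨R, x⟩ h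
    simp only [mem_sigma, mem_powersetCard, mem_sdiff] at h ⊢
    refine ⟨⟨(erase_subset _ _).trans h.1.1, ?_⟩, h.1.1 h.2, notMem_erase _ _⟩
    rw [card_erase_of_mem h.2]; omega
  · rintro ⟨T, x⟩ h
    simp only [mem_sigma, mem_powersetCard, mem_sdiff] at h ⊢
    refine ⟨⟨insert_subset h.2.1 h.1.1, ?_⟩, mem_insert_self _ _⟩
    rw [card_insert_of_notMem h.2.2]; omega
  · rintro ⟨R, x⟩ h
    simp only [mem_sigma] at h
    simp [insert_erase h.2]
  · rintro ⟨T, x⟩ h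
    simp only [mem_sigma, mem_sdiff] at h
    simp [erase_insert h.2.2]
  · rintro ⟨R, x⟩ h
    simp only [mem_sigma] at h
    simp [insert_erase h.2]

lemma avg_diff (V : Finset β) (v : β) (m : ℕ) (hm : m < #V)
    (f : Finset β → ℝ) (c : ℝ)
    (hf : ∀ T ⊆ V, ∀ a ∈ V, a ∉ T → |f (insert a T) - f (insert v T)| ≤ c) :
    |(∑ R ∈ V.powersetCard (m + 1), f R) / ((#V).choose (m + 1) : ℝ) -
      (∑ R ∈ V.powersetCard m, f (insert v R)) / ((#V).choose m : ℝ)| ≤ c := by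
  have hC1 : (0 : ℝ) < (#V).choose (m + 1) := by exact_mod_cast Nat.choose_pos (by omega)
  have hC0 : (0 : ℝ) < (#V).choose m := by exact_mod_cast Nat.choose_pos (by omega)
  have hch : ((#V).choose (m + 1) : ℝ) * (m + 1) = (#V).choose m * ((#V : ℝ) - m) := by
    have := Nat.choose_succ_right_eq #V m
    rw [← Nat.cast_sub hm.le]
    exact_mod_cast this
  have hN : (0 : ℝ) < (#V : ℝ) - m := by
    have : (m : ℝ) < #V := by exact_mod_cast hm
    linarith
  have hd := double_count V m f
  have h2 : ((#V : ℝ) - m) * ∑ T ∈ V.powersetCard m, f (insert v T) =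
      ∑ T ∈ V.powersetCard m, ∑ x ∈ V \ T, f (insert v T) := by
    rw [mul_sum]
    refine sum_congr rfl fun T hT => ?_
    rw [sum_const, card_sdiff_of_subset (mem_powersetCard.1 hT).1, (mem_powersetCard.1 hT).2,
      nsmul_eq_mul, Nat.cast_sub hm.le]
  have h3 : |((m : ℝ) + 1) * ∑ R ∈ V.powersetCard (m + 1), f R -
      ((#V : ℝ) - m) * ∑ T ∈ V.powersetCard m, f (insert v T)| ≤
      (#V).choose m * (((#V : ℝ) - m) * c) := by
    rw [hd, h2, ← sum_sub_distrib]
    simp_rw [← sum_sub_distrib]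
    calc _ ≤ ∑ T ∈ V.powersetCard m, ∑ x ∈ V \ T, |f (insert x T) - f (insert v T)| :=
          (abs_sum_le_sum_abs _ _).trans (sum_le_sum fun T _ => abs_sum_le_sum_abs _ _)
      _ ≤ ∑ T ∈ V.powersetCard m, ((#V : ℝ) - m) * c := by
          refine sum_le_sum fun T hT => ?_
          have hT' := mem_powersetCard.1 hT
          calc _ ≤ ∑ x ∈ V \ T, c :=
                sum_le_sum fun x hx => hf T hT'.1 x (mem_sdiff.1 hx).1 (mem_sdiff.1 hx).2
            _ = _ := by
                rw [sum_const, card_sdiff_of_subset hT'.1, hT'.2,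
                  nsmul_eq_mul, Nat.cast_sub hm.le]
      _ = _ := by rw [sum_const, card_powersetCard, nsmul_eq_mul]
  set F := ∑ R ∈ V.powersetCard (m + 1), f R
  set G := ∑ R ∈ V.powersetCard m, f (insert v R)
  have hK : (0 : ℝ) < (#V).choose m * ((#V : ℝ) - m) := mul_pos hC0 hN
  have e : ((m : ℝ) + 1) * F - ((#V : ℝ) - m) * G =
      ((#V).choose m * ((#V : ℝ) - m)) *
        (F / ((#V).choose (m + 1) : ℝ) - G / ((#V).choose m : ℝ)) := by
    rw [mul_sub, ← hch]
    nth_rw 2 [hch]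
    field_simp
  rw [e, abs_mul, abs_of_pos hK, ← mul_assoc] at h3
  exact le_of_mul_le_mul_left h3 hK

lemma mgf_bound (c : ℝ) (V : Finset β) : ∀ (m : ℕ) (f : Finset β → ℝ),
    (∀ T ⊆ V, ∀ a ∈ V, ∀ b ∈ V, a ∉ T → b ∉ T → |f (insert a T) - f (insert b T)| ≤ c) →
    ∑ R ∈ V.powersetCard m,
      Real.exp (f R - (∑ R ∈ V.powersetCard m, f R) / ((#V).choose m : ℝ)) ≤
      ((#V).choose m : ℝ) * Real.exp (c ^ 2 / 2 * #V) := by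
  induction V using Finset.induction_on with
  | empty =>
    intro m f _
    cases m with
    | zero => simp
    | succ m =>
      have : powersetCard (m + 1) (∅ : Finset β) = ∅ := by
        rw [powersetCard_eq_empty]; simp
      rw [this]; simp
  | insert v V hv ih =>
    intro m f hf
    rw [card_insert_of_notMem hv]
    cases m with
    | zero => simp; positivity
    | succ m =>
      rcases lt_trichotomy m #V with hm | hm | hm
      · have ih0 := ih (m + 1) f (fun T hT a ha b hb h1 h2 =>
          hf T (hT.trans (subset_insert _ _)) a (mem_insert_of_mem ha) b
            (mem_insert_of_mem hb) h1 h2)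
        have ih1 := ih m (fun R => f (insert v R)) (fun T hT a ha b hb h1 h2 => by
          have hav : a ≠ v := fun h => hv (h ▸ ha)
          have hbv : b ≠ v := fun h => hv (h ▸ hb)
          have := hf (insert v T) (insert_subset_insert _ hT) a (mem_insert_of_mem ha) b
            (mem_insert_of_mem hb) (by simp [hav, h1]) (by simp [hbv, h2])
          rwa [insert_comm a, insert_comm b] at this)
        have hd := avg_diff V v m hm f c (fun T hT a ha h1 =>
          hf T (hT.trans (subset_insert _ _)) a (mem_insert_of_mem ha) v
            (mem_insert_self _ _) h1 (fun h => hv (hT h)))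
        have hC1 : (0 : ℝ) < (#V).choose (m + 1) := by exact_mod_cast Nat.choose_pos (by omega)
        have hC0 : (0 : ℝ) < (#V).choose m := by exact_mod_cast Nat.choose_pos (by omega)
        rw [sum_split V v hv, sum_split V v hv, Nat.choose_succ_succ, Nat.cast_add]
        simp only [Nat.succ_eq_add_one]
        generalize ((#V).choose (m + 1) : ℝ) = C1 at *
        generalize ((#V).choose m : ℝ) = C0 at *
        generalize hA0 : (∑ R ∈ V.powersetCard (m + 1), f R) / C1 = A0 at *
        generalize hA1 : (∑ R ∈ V.powersetCard m, f (insert v R)) / C0 = A1 at *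
        have hK : 0 < C0 + C1 := by linarith
        have hA : (∑ R ∈ V.powersetCard (m + 1), f R +
            ∑ R ∈ V.powersetCard m, f (insert v R)) / (C0 + C1) =
            C1 / (C0 + C1) * A0 + C0 / (C0 + C1) * A1 := by
          rw [← hA0, ← hA1]; field_simp
        rw [hA]
        have htp := two_point (C0 / (C0 + C1)) (C1 / (C0 + C1)) A0 A1 c
          (by positivity) (by positivity) (by field_simp; ring) hd
        generalize hAA : C1 / (C0 + C1) * A0 + C0 / (C0 + C1) * A1 = A at *
        have s0 : ∑ R ∈ V.powersetCard (m + 1), Real.exp (f R - A) =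
            Real.exp (A0 - A) * ∑ R ∈ V.powersetCard (m + 1), Real.exp (f R - A0) := by
          rw [mul_sum]
          refine sum_congr rfl fun R _ => ?_
          rw [← Real.exp_add]; congr 1; ring
        have s1 : ∑ R ∈ V.powersetCard m, Real.exp (f (insert v R) - A) =
            Real.exp (A1 - A) * ∑ R ∈ V.powersetCard m, Real.exp (f (insert v R) - A1) := by
          rw [mul_sum]
          refine sum_congr rfl fun R _ => ?_
          rw [← Real.exp_add]; congr 1; ring
        rw [s0, s1]
        calc _ ≤ Real.exp (A0 - A) * (C1 * Real.exp (c ^ 2 / 2 * #V)) +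
              Real.exp (A1 - A) * (C0 * Real.exp (c ^ 2 / 2 * #V)) := by gcongr
          _ = (C0 + C1) * Real.exp (c ^ 2 / 2 * #V) * (C1 / (C0 + C1) * Real.exp (A0 - A) +
              C0 / (C0 + C1) * Real.exp (A1 - A)) := by field_simp
          _ ≤ (C0 + C1) * Real.exp (c ^ 2 / 2 * #V) * Real.exp (c ^ 2 / 2) := by gcongr
          _ = _ := by
            rw [mul_assoc, ← Real.exp_add]; congr 2; push_cast; ring
      · have : powersetCard (m + 1) (insert v V) = {insert v V} := by
          have := powersetCard_self (insert v V)
          rwa [card_insert_of_notMem hv, ← hm] at this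
        rw [this, ← hm]
        simp; positivity
      · have : powersetCard (m + 1) (insert v V) = ∅ := by
          rw [powersetCard_eq_empty, card_insert_of_notMem hv]; omega
        rw [this]; simp; positivity

/-- Lower tail bound. -/
lemma tail_bound (c t : ℝ) (hc : 0 < c) (ht : 0 < t) (V : Finset β) (hV : 0 < #V) (m : ℕ)
    (f : Finset β → ℝ)
    (hf : ∀ T ⊆ V, ∀ a ∈ V, ∀ b ∈ V, a ∉ T → b ∉ T → |f (insert a T) - f (insert b T)| ≤ c)
    (A : ℝ) (hA : A * ((#V).choose m : ℝ) ≤ ∑ R ∈ V.powersetCard m, f R) :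
    (#{R ∈ V.powersetCard m | f R < A - t} : ℝ) ≤
      ((#V).choose m : ℝ) * Real.exp (-(t ^ 2 / (2 * c ^ 2 * #V))) := by
  rcases (Nat.zero_le ((#V).choose m)).eq_or_lt with h0 | h0
  · have : V.powersetCard m = ∅ := by rw [← card_eq_zero, card_powersetCard, ← h0]
    rw [this]; simp; positivity
  have hN : (0 : ℝ) < #V := by exact_mod_cast hV
  have hC : (0 : ℝ) < (#V).choose m := by exact_mod_cast h0
  set l : ℝ := t / (c ^ 2 * #V) with hl
  have hl0 : 0 < l := by positivity
  have h := mgf_bound (l * c) V m (fun R => -l * f R) (fun T hT a ha b hb h1 h2 => by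
    rw [← mul_sub, abs_mul, abs_neg, abs_of_pos hl0]
    exact mul_le_mul_of_nonneg_left (hf T hT a ha b hb h1 h2) hl0.le)
  simp only [← mul_sum] at h
  set M := ∑ R ∈ V.powersetCard m, f R
  have hAM : A ≤ M / (#V).choose m := by rwa [le_div_iff₀ hC]
  have h2 : (#{R ∈ V.powersetCard m | f R < A - t} : ℝ) * Real.exp (l * t) ≤
      ((#V).choose m : ℝ) * Real.exp ((l * c) ^ 2 / 2 * #V) := by
    refine le_trans ?_ h
    rw [← nsmul_eq_mul, ← sum_const]
    refine le_trans (sum_le_sum ?_) (sum_le_sum_of_subset_of_nonneg (filter_subset _ _)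
      (fun _ _ _ => (Real.exp_pos _).le))
    intro R hR
    have hR := (mem_filter.1 hR).2
    rw [Real.exp_le_exp, mul_div_assoc]
    nlinarith
  rw [← le_div_iff₀ (Real.exp_pos _), mul_div_assoc, ← Real.exp_sub] at h2
  have e : -(t ^ 2 / (2 * c ^ 2 * #V)) = (l * c) ^ 2 / 2 * #V - l * t := by
    rw [hl]; field_simp; ring
  rw [e]; exact h2

/-- the counting function -/
def cnt (H : Finset (Finset β)) (r : ℕ) (S R : Finset β) : ℕ :=
  #{B ∈ (R \ S).powersetCard r | S ∪ B ∈ H}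

lemma cnt_mono (H : Finset (Finset β)) (r : ℕ) (S : Finset β) {R R' : Finset β} (h : R ⊆ R') :
    cnt H r S R ≤ cnt H r S R' :=
  card_le_card (filter_subset_filter _ (powersetCard_mono (sdiff_subset_sdiff h le_rfl)))

lemma cnt_insert (H : Finset (Finset β)) (r : ℕ) (S T : Finset β) (a : β) :
    cnt H (r + 1) S (insert a T) ≤ cnt H (r + 1) S T + (#T) ^ r := by
  have : {B ∈ ((insert a T) \ S).powersetCard (r + 1) | S ∪ B ∈ H} ⊆
      {B ∈ (T \ S).powersetCard (r + 1) | S ∪ B ∈ H} ∪ (T.powersetCard r).image (insert a) := by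
    intro B hB
    simp only [mem_filter, mem_powersetCard, mem_union, mem_image] at hB ⊢
    by_cases ha : a ∈ B
    · right
      refine ⟨B.erase a, ⟨?_, ?_⟩, insert_erase ha⟩
      · intro x hx
        have hx' := mem_erase.1 hx
        have := (mem_sdiff.1 (hB.1.1 hx'.2)).1
        exact (mem_insert.1 this).resolve_left hx'.1
      · rw [card_erase_of_mem ha]; omega
    · left
      refine ⟨⟨?_, hB.1.2⟩, hB.2⟩
      intro x hx
      have := mem_sdiff.1 (hB.1.1 hx)
      refine mem_sdiff.2 ⟨(mem_insert.1 this.1).resolve_left (fun h => ha (h ▸ hx)), this.2⟩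
  refine (card_le_card this).trans ((card_union_le _ _).trans ?_)
  refine Nat.add_le_add_left (card_image_le.trans ?_) _
  rw [card_powersetCard]
  exact Nat.choose_le_pow _ _

lemma cnt_lip (H : Finset (Finset β)) (r : ℕ) (S V : Finset β) :
    ∀ T ⊆ V, ∀ a ∈ V, ∀ b ∈ V, a ∉ T → b ∉ T →
      |(cnt H (r + 1) S (insert a T) : ℝ) - cnt H (r + 1) S (insert b T)| ≤ (#V : ℝ) ^ r := by
  intro T hT a _ b _ _ _
  have hp : ((#T : ℝ)) ^ r ≤ (#V : ℝ) ^ r :=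
    pow_le_pow_left₀ (by positivity) (by exact_mod_cast card_le_card hT) _
  have a1 : (cnt H (r + 1) S (insert a T) : ℝ) ≤ cnt H (r + 1) S T + (#T : ℝ) ^ r := by
    exact_mod_cast cnt_insert H r S T a
  have b1 : (cnt H (r + 1) S (insert b T) : ℝ) ≤ cnt H (r + 1) S T + (#T : ℝ) ^ r := by
    exact_mod_cast cnt_insert H r S T b
  have a2 : (cnt H (r + 1) S T : ℝ) ≤ cnt H (r + 1) S (insert a T) := by
    exact_mod_cast cnt_mono H (r + 1) S (subset_insert a T)
  have b2 : (cnt H (r + 1) S T : ℝ) ≤ cnt H (r + 1) S (insert b T) := by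
    exact_mod_cast cnt_mono H (r + 1) S (subset_insert b T)
  rw [abs_le]; constructor <;> linarith

lemma super_count (V B : Finset β) (hB : B ⊆ V) (m : ℕ) (hm : #B ≤ m) :
    (#V - #B).choose (m - #B) ≤ #{R ∈ V.powersetCard m | B ⊆ R} := by
  rw [← card_sdiff_of_subset hB, ← card_powersetCard]
  refine card_le_card_of_injOn (fun Q => Q ∪ B) ?_ ?_
  · intro Q hQ
    have hQ := mem_powersetCard.1 hQ
    simp only [coe_filter, Set.mem_ofPred_eq, mem_powersetCard]
    refine ⟨⟨union_subset (hQ.1.trans sdiff_subset) hB, ?_⟩, subset_union_right⟩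
    rw [card_union_of_disjoint (disjoint_of_subset_left hQ.1 sdiff_disjoint), hQ.2]
    omega
  · intro Q hQ Q' hQ' h
    have hQ := (mem_powersetCard.1 hQ).1
    have hQ' := (mem_powersetCard.1 hQ').1
    have e1 := union_sdiff_cancel_right (disjoint_of_subset_left hQ sdiff_disjoint)
    have e2 := union_sdiff_cancel_right (disjoint_of_subset_left hQ' sdiff_disjoint)
    simp only at h
    rw [← e1, ← e2, h]

lemma cnt_avg (H : Finset (Finset β)) (r : ℕ) (S V : Finset β) (m : ℕ) (hm : m ≤ #V) (μ : ℝ)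
    (h : μ * ((#V).choose r : ℝ) ≤ cnt H r S V) :
    μ * (m.choose r : ℝ) * ((#V).choose m : ℝ) ≤
      ∑ R ∈ V.powersetCard m, (cnt H r S R : ℝ) := by
  rcases lt_or_ge m r with hr | hr
  · rw [Nat.choose_eq_zero_of_lt hr, Nat.cast_zero, mul_zero, zero_mul]
    exact sum_nonneg fun _ _ => Nat.cast_nonneg _
  have h1 : cnt H r S V * (#V - r).choose (m - r) ≤ ∑ R ∈ V.powersetCard m, cnt H r S R := by
    have e : ∀ R ∈ V.powersetCard m, cnt H r S R =
        #{B ∈ {B ∈ (V \ S).powersetCard r | S ∪ B ∈ H} | B ⊆ R} := by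
      intro R hR
      have hR := (mem_powersetCard.1 hR).1
      unfold cnt
      congr 1
      ext B
      simp only [mem_filter, mem_powersetCard, subset_sdiff]
      constructor
      · rintro ⟨⟨⟨a, b⟩, c⟩, d⟩
        exact ⟨⟨⟨⟨a.trans hR, b⟩, c⟩, d⟩, a⟩
      · rintro ⟨⟨⟨⟨a, b⟩, c⟩, d⟩, a'⟩
        exact ⟨⟨⟨a', b⟩, c⟩, d⟩
    rw [sum_congr rfl e]
    have := sum_card_bipartiteAbove_eq_sum_card_bipartiteBelow
      (s := V.powersetCard m) (t := {B ∈ (V \ S).powersetCard r | S ∪ B ∈ H})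
      (fun R B => B ⊆ R)
    unfold bipartiteAbove bipartiteBelow at this
    rw [this]
    unfold cnt
    rw [← smul_eq_mul, ← sum_const]
    refine sum_le_sum fun B hB => ?_
    have hB := (mem_powersetCard.1 (mem_filter.1 hB).1)
    have := super_count V B (hB.1.trans sdiff_subset) m (by omega)
    rwa [hB.2] at this
  have h1' : (cnt H r S V : ℝ) * ((#V - r).choose (m - r) : ℝ) ≤
      ∑ R ∈ V.powersetCard m, (cnt H r S R : ℝ) := by exact_mod_cast h1
  refine le_trans ?_ h1'
  have h2 : ((#V).choose m : ℝ) * m.choose r = (#V).choose r * (#V - r).choose (m - r) := by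
    exact_mod_cast Nat.choose_mul (n := #V) hr
  rw [mul_assoc, mul_comm (m.choose r : ℝ), h2, ← mul_assoc]
  gcongr

lemma asymp (s : ℕ) (δ : ℝ) (hδ : 0 < δ) :
    ∃ n₀ : ℕ, ∀ n ≥ n₀, (n : ℝ) ^ s * Real.exp (-((n : ℝ) ^ (1 / 3 : ℝ) / 2)) ≤ δ := by
  have h := Real.tendsto_pow_mul_exp_neg_atTop_nhds_zero (3 * s)
  have h1 : Filter.Tendsto (fun n : ℕ => (n : ℝ) ^ (1 / 3 : ℝ) / 2) Filter.atTop Filter.atTop :=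
    ((tendsto_rpow_atTop (by norm_num)).comp tendsto_natCast_atTop_atTop).atTop_div_const
      (by norm_num)
  have h2 := h.comp h1
  have h3 := h2.eventually (ge_mem_nhds (b := 0) (a := δ / 2 ^ (3 * s)) (by positivity))
  obtain ⟨n₀, hn⟩ := Filter.eventually_atTop.1 h3
  refine ⟨n₀, fun n h => ?_⟩
  have := hn n h
  simp only [Function.comp] at this
  rw [div_pow, div_mul_eq_mul_div, div_le_div_iff_of_pos_right (by positivity)] at this
  refine le_trans (le_of_eq ?_) this
  congr 1
  rw [pow_mul, ← Real.rpow_natCast (_ ^ _) 3, ← Real.rpow_mul (by positivity)]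
  norm_num


/-- Reservoir lemma: in a `k`-graph in which every `s`-set has degree at least
`μ C(n, k-s)`, for a uniformly random subset `R` of size `αn`, with probability
at least `1 - δ` every `s`-set `S` satisfies
`|N_H(S) ∩ C(R, k-s)| ≥ μ C(αn, k-s) - n^{k-s-1/3}`. -/
theorem reservoir_lemma
    (k s : ℕ) (hk : 2 ≤ k) (hs1 : 1 ≤ s) (hs2 : s ≤ k - 1)
    (α μ : ℝ) (hα : 0 < α) (hμ : 0 < μ) (δ : ℝ) (hδ : 0 < δ) :
    ∃ n₀ : ℕ, ∀ n ≥ n₀, ∀ m : ℕ, (m : ℝ) = α * n →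
      ∀ H : Finset (Finset (Fin n)), (∀ e ∈ H, e.card = k) →
        (∀ S : Finset (Fin n), S.card = s →
          μ * (Nat.choose n (k - s) : ℝ) ≤
            ((((Finset.univ \ S).powersetCard (k - s)).filter
                (fun B => S ∪ B ∈ H)).card : ℝ)) →
        (1 - δ) * (((Finset.univ : Finset (Fin n)).powersetCard m).card : ℝ) ≤
          ((((Finset.univ : Finset (Fin n)).powersetCard m).filter
              (fun R =>
                ∀ S : Finset (Fin n), S.card = s →
                  μ * (Nat.choose m (k - s) : ℝ) -
                      (n : ℝ) ^ ((k : ℝ) - (s : ℝ) - 1 / 3) ≤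
                    ((((R \ S).powersetCard (k - s)).filter
                        (fun B => S ∪ B ∈ H)).card : ℝ))).card : ℝ) := by
  obtain ⟨n₀, hn₀⟩ := asymp s δ hδ
  refine ⟨max n₀ 1, fun n hn m _ H _ hdeg => ?_⟩
  have hn0 : n₀ ≤ n := (le_max_left _ _).trans hn
  have hn1 : 1 ≤ n := (le_max_right _ _).trans hn
  have hnR : (0 : ℝ) < n := by exact_mod_cast hn1
  rcases lt_or_ge n m with hnm | hnm
  · have : (univ : Finset (Fin n)).powersetCard m = ∅ := by
      rw [powersetCard_eq_empty]; simpa using hnm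
    rw [this]; simp
  obtain ⟨r, hr⟩ : ∃ r, k - s = r + 1 := ⟨k - s - 1, by omega⟩
  have hkr : (k : ℝ) - s = r + 1 := by
    rw [← Nat.cast_sub (by omega), hr]; push_cast; ring
  rw [hr] at hdeg
  simp only [hr, hkr]
  set t : ℝ := (n : ℝ) ^ ((r : ℝ) + 1 - 1 / 3) with ht
  have htp : 0 < t := Real.rpow_pos_of_pos hnR _
  have hexp : t ^ 2 / (2 * ((n : ℝ) ^ r) ^ 2 * n) = (n : ℝ) ^ (1 / 3 : ℝ) / 2 := by
    have e1 : t ^ 2 = (n : ℝ) ^ (1 / 3 : ℝ) * (((n : ℝ) ^ r) ^ 2 * n) := by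
      rw [ht, ← Real.rpow_natCast, ← Real.rpow_mul hnR.le, ← pow_mul, ← pow_succ,
        ← Real.rpow_natCast (n : ℝ) (r * 2 + 1), ← Real.rpow_add hnR]
      congr 1; push_cast; ring
    rw [e1]; field_simp
  set P := (univ : Finset (Fin n)).powersetCard m with hP
  have hPc : (#P : ℝ) = (n.choose m : ℝ) := by rw [hP, card_powersetCard]; simp
  have hbad : ∀ S : Finset (Fin n), #S = s →
      (#{R ∈ P | (cnt H (r + 1) S R : ℝ) < μ * (m.choose (r + 1) : ℝ) - t} : ℝ) ≤
        #P * Real.exp (-((n : ℝ) ^ (1 / 3 : ℝ) / 2)) := by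
    intro S hS
    have h1 := cnt_avg H (r + 1) S univ m (by simpa using hnm) μ (by
      simpa [cnt] using hdeg S hS)
    have h2 := tail_bound ((n : ℝ) ^ r) t (by positivity) htp (univ : Finset (Fin n))
      (by simp; omega) m (fun R => (cnt H (r + 1) S R : ℝ))
      (by simpa using cnt_lip H r S (univ : Finset (Fin n))) _ h1
    rw [card_univ, Fintype.card_fin, hexp, ← hPc] at h2
    exact h2
  set good := fun R : Finset (Fin n) => ∀ S : Finset (Fin n), #S = s →
    μ * (m.choose (r + 1) : ℝ) - t ≤ ((#{B ∈ (R \ S).powersetCard (r + 1) | S ∪ B ∈ H} : ℕ) : ℝ)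
    with hgood
  have hsplit : (#{R ∈ P | good R} : ℝ) + #{R ∈ P | ¬ good R} = #P := by
    exact_mod_cast card_filter_add_card_filter_not (s := P) good
  have hsub : {R ∈ P | ¬ good R} ⊆ ((univ : Finset (Fin n)).powersetCard s).biUnion
      (fun S => {R ∈ P | (cnt H (r + 1) S R : ℝ) < μ * (m.choose (r + 1) : ℝ) - t}) := by
    intro R hR
    obtain ⟨hRP, hR⟩ := mem_filter.1 hR
    simp only [hgood, not_forall, not_le] at hR
    obtain ⟨S, hS, hlt⟩ := hR
    exact mem_biUnion.2 ⟨S, mem_powersetCard.2 ⟨subset_univ _, hS⟩, mem_filter.2 ⟨hRP, hlt⟩⟩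
  have hle : (#{R ∈ P | ¬ good R} : ℝ) ≤ δ * #P := by
    calc (#{R ∈ P | ¬ good R} : ℝ) ≤ ∑ S ∈ (univ : Finset (Fin n)).powersetCard s,
          (#{R ∈ P | (cnt H (r + 1) S R : ℝ) < μ * (m.choose (r + 1) : ℝ) - t} : ℝ) := by
          exact_mod_cast (card_le_card hsub).trans card_biUnion_le
      _ ≤ ∑ S ∈ (univ : Finset (Fin n)).powersetCard s,
          #P * Real.exp (-((n : ℝ) ^ (1 / 3 : ℝ) / 2)) :=
          sum_le_sum fun S hS => hbad S (mem_powersetCard.1 hS).2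
      _ = (n.choose s : ℝ) * Real.exp (-((n : ℝ) ^ (1 / 3 : ℝ) / 2)) * #P := by
          rw [sum_const, card_powersetCard, nsmul_eq_mul]; simp; ring
      _ ≤ (n : ℝ) ^ s * Real.exp (-((n : ℝ) ^ (1 / 3 : ℝ) / 2)) * #P := by
          gcongr; exact_mod_cast Nat.choose_le_pow n s
      _ ≤ δ * #P := by gcongr; exact hn₀ n hn0
  have : (#{R ∈ P | good R} : ℝ) ≥ (1 - δ) * #P := by linarith
  convert this using 3
end
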